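/- arXiv:1609.00190 — 9 statements merged into one kernel-verified Lean document; each statement's English description precedes it below -/
import Mathlib

section
/- Let 𝓗 be a complex Hilbert space and let H : ℝ → B(𝓗) be norm-continuous. Then there exists a unique map U : ℝ × ℝ → B(𝓗) such that U(s,s) = 1 for all s and, for each fixed s, the map t ↦ U(t,s) is differentiable in operator norm with ∂ₜU(t,s) = i·H(t)·U(t,s). Moreover this U also satisfies ∂ₛU(t,s) = −i·U(t,s)·H(s) for each fixed t, the group property U(t,r)·U(r,s) = U(t,s) for all t, r, s ∈ ℝ, and each U(t,s) is invertible in B(𝓗) with inverse U(s,t). -/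
open Set MeasureTheory intervalIntegral Interval in
/-- A linear equation `x' = L(t) x` in a Banach space, with `L` norm-continuous on `ℝ`, has a
global solution through every initial value. -/
theorem exists_hasDerivAt_linear_of_continuous {E : Type*} [NormedAddCommGroup E]
    [NormedSpace ℝ E] [CompleteSpace E] {L : ℝ → E →L[ℝ] E} (hL : Continuous L) (s : ℝ) (x₀ : E) :
    ∃ x : ℝ → E, x s = x₀ ∧ ∀ t, HasDerivAt x (L t (x t)) t := by
  let u : ℕ → ℝ → E := fun n => n.rec (fun _ => x₀) (fun _ v t => ∫ τ in s..t, L τ (v τ))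
  have u_succ (n : ℕ) (t : ℝ) : u (n + 1) t = ∫ τ in s..t, L τ (u n τ) := rfl
  have hu (n : ℕ) : Continuous (u n) := by
    induction n with
    | zero => exact continuous_const
    | succ n ih => exact continuous_primitive (fun a b => (hL.clm_apply ih).intervalIntegrable a b) s
  have hu' (n : ℕ) (t : ℝ) : HasDerivAt (u (n + 1)) (L t (u n t)) t :=
    (hL.clm_apply (hu n)).integral_hasStrictDerivAt s t |>.hasDerivAt
  have u_base (n : ℕ) : u (n + 1) s = 0 := by rw [u_succ, integral_same]
  have bound (R : ℝ) : ∃ M, 0 ≤ M ∧ ∀ t ∈ Metric.ball s R, ‖L t‖ ≤ M ∧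
      ∀ n : ℕ, ‖u n t‖ ≤ ‖x₀‖ * (M ^ n * |t - s| ^ n / n.factorial) := by
    obtain ⟨M, hM⟩ := (isCompact_closedBall s R).exists_bound_of_continuousOn hL.continuousOn
    have hM' : ∀ t ∈ Metric.ball s R, ‖L t‖ ≤ max M 0 := fun t ht =>
      (hM t (Metric.ball_subset_closedBall ht)).trans (le_max_left _ _)
    refine ⟨max M 0, le_max_right _ _, fun t ht => ⟨hM' t ht, fun n => ?_⟩⟩
    generalize hM₀ : max M 0 = K at hM'
    have hK : 0 ≤ K := hM₀ ▸ le_max_right _ _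
    induction n generalizing t with
    | zero => simp [u]
    | succ n ih =>
      have hs : s ∈ Metric.ball s R := Metric.mem_ball_self (Metric.pos_of_mem_ball ht)
      have hsub : Ι s t ⊆ Metric.ball s R := by
        rw [Real.ball_eq_Ioo] at *
        exact uIoc_subset_uIcc.trans (ordConnected_Ioo.uIcc_subset hs ht)
      calc ‖u (n + 1) t‖ ≤ ∫ τ in Ι s t, ‖L τ (u n τ)‖ := norm_integral_le_integral_norm_uIoc
        _ ≤ ∫ τ in Ι s t, ‖x₀‖ * K ^ (n + 1) / n.factorial * |τ - s| ^ n := by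
          refine setIntegral_mono_on ?_ ?_ measurableSet_uIoc fun τ hτ => ?_
          · exact ((hL.clm_apply (hu n)).norm.intervalIntegrable s t).def'
          · exact (Continuous.intervalIntegrable (u := fun τ =>
              ‖x₀‖ * K ^ (n + 1) / n.factorial * |τ - s| ^ n) (by fun_prop) s t).def'
          · calc ‖L τ (u n τ)‖ ≤ K * (‖x₀‖ * (K ^ n * |τ - s| ^ n / n.factorial)) :=
                  (L τ).le_of_opNorm_le_of_le (hM' τ (hsub hτ)) (ih τ (hsub hτ))
              _ = _ := by ring
        _ = _ := by
          rw [MeasureTheory.integral_const_mul, integral_pow_abs_sub_uIoc, Nat.factorial_succ]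
          push_cast
          field_simp
  refine ⟨fun t => x₀ + ∑' n, u (n + 1) t, by simp [u_base], fun t => ?_⟩
  obtain ⟨M, hM, hbound⟩ := bound (|t - s| + 1)
  have ht : t ∈ Metric.ball s (|t - s| + 1) := by simp [Real.dist_eq]
  have hs : s ∈ Metric.ball s (|t - s| + 1) := Metric.mem_ball_self (by positivity)
  generalize |t - s| + 1 = R at *
  have hexp : Summable fun n : ℕ => ‖x₀‖ * ((M * R) ^ n / n.factorial) :=
    (Real.summable_pow_div_factorial (M * R)).mul_left _
  have hle (n : ℕ) (y : ℝ) (hy : y ∈ Metric.ball s R) :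
      ‖u n y‖ ≤ ‖x₀‖ * ((M * R) ^ n / n.factorial) := by
    refine ((hbound y hy).2 n).trans ?_
    rw [mul_pow]
    have : |y - s| ≤ R := (Metric.mem_ball.1 hy).le
    gcongr
  have hsum : Summable fun n => u n t := .of_norm_bounded hexp fun n => hle n t ht
  have hder := hasDerivAt_tsum_of_isPreconnected (hexp.mul_left M) Metric.isOpen_ball
    (convex_ball s R).isPreconnected (fun n y _ => hu' n y)
    (fun n y hy => (L y).le_of_opNorm_le_of_le (hbound y hy).1 (hle n y hy)) hs
    (by simpa only [u_base] using summable_zero) ht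
  rw [← (L t).map_tsum hsum, hsum.tsum_eq_zero_add] at hder
  exact hder.const_add x₀

/-- If `Z' = -Z G` and `X' = G X` then `Z X` is constant. -/
theorem mul_eq_mul_of_hasDerivAt {A : Type*} [NormedRing A] [NormedAlgebra ℝ A] {G Z X : ℝ → A}
    (hZ : ∀ t, HasDerivAt Z (-(Z t * G t)) t) (hX : ∀ t, HasDerivAt X (G t * X t) t) (a b : ℝ) :
    Z a * X a = Z b * X b := by
  have h (t : ℝ) : HasDerivAt (fun τ => Z τ * X τ) 0 t := by
    simpa [mul_assoc] using (hZ t).fun_mul (hX t)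
  exact is_const_of_deriv_eq_zero (fun t => (h t).differentiableAt) (fun t => (h t).deriv) a b

/-- Existence, uniqueness and cocycle property of the propagator of `X' = G(t) X` in a Banach
algebra. -/
theorem exists_propagator {A : Type*} [NormedRing A] [NormedAlgebra ℝ A] [CompleteSpace A]
    {G : ℝ → A} (hG : Continuous G) :
    ∃ U : ℝ → ℝ → A,
      ((∀ s, U s s = 1) ∧ ∀ s t, HasDerivAt (fun τ => U τ s) (G t * U t s) t) ∧
      (∀ V : ℝ → ℝ → A,
        ((∀ s, V s s = 1) ∧ ∀ s t, HasDerivAt (fun τ => V τ s) (G t * V t s) t) → V = U) ∧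
      (∀ t s, HasDerivAt (fun σ => U t σ) (-(U t s * G s)) s) ∧
      (∀ t r s, U t r * U r s = U t s) ∧
      (∀ t s, U t s * U s t = 1 ∧ U s t * U t s = 1) := by
  choose W hW1 hW using fun s => exists_hasDerivAt_linear_of_continuous
    (L := fun t => ContinuousLinearMap.mul ℝ A (G t)) (by fun_prop) s 1
  choose Z hZ1 hZ using fun s => exists_hasDerivAt_linear_of_continuous
    (L := fun t => -(ContinuousLinearMap.mul ℝ A).flip (G t)) (by fun_prop) s 1
  simp only [ContinuousLinearMap.mul_apply', neg_apply, ContinuousLinearMap.flip_apply] at hW hZ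
  have hZW (s t : ℝ) : Z s t = W t s := by
    simpa [hZ1, hW1] using mul_eq_mul_of_hasDerivAt (hZ s) (hW t) t s
  have hcocycle (t r s : ℝ) : W r t * W s r = W s t := by
    simpa [hZ1, hZW] using mul_eq_mul_of_hasDerivAt (hZ t) (hW s) r t
  have hinv (t s : ℝ) : W s t * W t s = 1 := by rw [hcocycle, hW1]
  refine ⟨fun t s => W s t, ⟨hW1, hW⟩, fun V hV => ?_, fun t s => ?_, hcocycle,
    fun t s => ⟨hinv t s, hinv s t⟩⟩
  · funext t s
    have h : W t s * V t s = 1 := by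
      simpa [hZ1, hZW, hV.1] using mul_eq_mul_of_hasDerivAt (hZ s) (hV.2 s) t s
    calc V t s = W s t * W t s * V t s := by rw [hinv, one_mul]
      _ = W s t := by rw [mul_assoc, h, mul_one]
  · simpa only [← hZW] using hZ t s


/-- Existence and uniqueness of the Cauchy evolution generated by a
norm-continuous family `H : ℝ → B(𝓗)` of bounded operators on a complex Hilbert space `𝓗`:
there is a unique `U : ℝ × ℝ → B(𝓗)` with `U(s,s) = 1` and `∂ₜ U(t,s) = i·H(t)·U(t,s)`;
moreover this `U` satisfies `∂ₛ U(t,s) = −i·U(t,s)·H(s)`, the group property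
`U(t,r)·U(r,s) = U(t,s)`, and each `U(t,s)` is invertible with inverse `U(s,t)`. -/
theorem stmt0 {𝓗 : Type*} [NormedAddCommGroup 𝓗] [InnerProductSpace ℂ 𝓗] [CompleteSpace 𝓗]
    (H : ℝ → (𝓗 →L[ℂ] 𝓗)) (hH : Continuous H) :
    ∃ U : ℝ → ℝ → (𝓗 →L[ℂ] 𝓗),
      ((∀ s, U s s = 1) ∧
        (∀ s t, HasDerivAt (fun τ => U τ s) (Complex.I • (H t * U t s)) t)) ∧
      (∀ V : ℝ → ℝ → (𝓗 →L[ℂ] 𝓗),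
        ((∀ s, V s s = 1) ∧
          (∀ s t, HasDerivAt (fun τ => V τ s) (Complex.I • (H t * V t s)) t)) → V = U) ∧
      (∀ t s, HasDerivAt (fun σ => U t σ) (-(Complex.I • (U t s * H s))) s) ∧
      (∀ t r s, U t r * U r s = U t s) ∧
      (∀ t s, U t s * U s t = 1 ∧ U s t * U t s = 1) := by
  have hG : Continuous fun t => Complex.I • H t := hH.const_smul Complex.I
  simpa only [smul_mul_assoc, mul_smul_comm] using exists_propagator hG
end

section
/- Let 𝓗 be a complex Hilbert space, H : ℝ → B(𝓗) norm-continuous, and U the Cauchy evolution generated by H. Suppose q ∈ B(𝓗) satisfies H(t)* q = q H(t) for all t ∈ ℝ, where H(t)* is the Hilbert-space adjoint. Then U(t,s)* q U(t,s) = q for all t, s ∈ ℝ (the evolution preserves the hermitian form defined by q). -/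
/-- If `U` is the Cauchy evolution generated by a norm-continuous
`H : ℝ → B(𝓗)` and `q ∈ B(𝓗)` satisfies `H(t)* q = q H(t)` for all `t`, then
`U(t,s)* q U(t,s) = q` for all `t, s` (the evolution preserves the hermitian form `q`). -/
theorem stmt1 {𝓗 : Type*} [NormedAddCommGroup 𝓗] [InnerProductSpace ℂ 𝓗] [CompleteSpace 𝓗]
    (H : ℝ → (𝓗 →L[ℂ] 𝓗)) (hH : Continuous H)
    (U : ℝ → ℝ → (𝓗 →L[ℂ] 𝓗))
    (hU1 : ∀ t, U t t = 1)
    (hU2 : ∀ s t, HasDerivAt (fun τ => U τ s) (Complex.I • (H t * U t s)) t)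
    (hU3 : ∀ t s, HasDerivAt (fun σ => U t σ) (-(Complex.I • (U t s * H s))) s)
    (q : 𝓗 →L[ℂ] 𝓗)
    (hq : ∀ t, ContinuousLinearMap.adjoint (H t) * q = q * H t) :
    ∀ t s, ContinuousLinearMap.adjoint (U t s) * q * U t s = q := by
  intro t s
  have key : ∀ τ, HasDerivAt (fun τ => star (U τ s) * q * U τ s) 0 τ := by
    intro τ
    have hstar : HasDerivAt (fun τ => star (U τ s)) (star (Complex.I • (H τ * U τ s))) τ :=
      (hU2 s τ).star
    have hτ : star (H τ) * q = q * H τ := hq τ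
    have hzero : star (Complex.I • (H τ * U τ s)) * q * U τ s
        + star (U τ s) * q * (Complex.I • (H τ * U τ s)) = 0 := by
      have hassoc : star (U τ s) * star (H τ) * q * U τ s
          = star (U τ s) * q * (H τ * U τ s) := by
        rw [mul_assoc (star (U τ s)), hτ]
        simp only [mul_assoc]
      rw [star_smul, star_mul, smul_mul_assoc, smul_mul_assoc, mul_smul_comm, hassoc]
      simp
    exact hzero ▸ (hstar.mul_const q).mul (hU2 s τ)
  have hconst := is_const_of_deriv_eq_zero (fun τ => (key τ).differentiableAt)
    (fun τ => (key τ).deriv) t s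
  simpa [hU1, ← ContinuousLinearMap.star_eq_adjoint] using hconst
end

section
/- Let 𝓗 be a complex Hilbert space, H : ℝ → B(𝓗) norm-continuous, and U the Cauchy evolution generated by H. Suppose there are constants C ≥ 0 and δ > 0 such that ‖H(t) − H(t)*‖ ≤ C·⟨t⟩^{−1−δ} for all t ∈ ℝ, where ⟨t⟩ = (1+t²)^{1/2}. Then sup_{t,s ∈ ℝ} ‖U(t,s)‖ < ∞. -/
/-- Two-sided Grönwall inequality on the whole line with an integrable rate `g`. -/
theorem le_mul_exp_integral_of_abs_deriv_le {f f' g : ℝ → ℝ}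
    (hg : Continuous g) (hgi : MeasureTheory.Integrable g)
    (hf : ∀ t, HasDerivAt f (f' t) t) (hf0 : ∀ t, 0 ≤ f t)
    (hfg : ∀ t, |f' t| ≤ g t * f t) (hg0 : ∀ t, 0 ≤ g t) (s t : ℝ) :
    f t ≤ f s * Real.exp (∫ x, g x) := by
  set G : ℝ → ℝ := fun t => ∫ x in (0 : ℝ)..t, g x with hG
  have hGd : ∀ t, HasDerivAt G (g t) t := fun t =>
    (hg.integral_hasStrictDerivAt 0 t).hasDerivAt
  have hGle : ∀ a b, a ≤ b → G b - G a ≤ ∫ x, g x := by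
    intro a b hab
    rw [hG, intervalIntegral.integral_interval_sub_left (hg.intervalIntegrable _ _)
      (hg.intervalIntegrable _ _), intervalIntegral.integral_of_le hab]
    exact MeasureTheory.setIntegral_le_integral hgi (Filter.Eventually.of_forall hg0)
  have hanti : Antitone fun t => f t * Real.exp (-G t) := by
    refine antitone_of_hasDerivAt_nonpos (fun t => (hf t).mul (hGd t).fun_neg.exp) fun t => ?_
    have := (abs_le.1 (hfg t)).2
    have := Real.exp_pos (-G t)
    simp only [Pi.zero_apply]
    nlinarith
  have hmono : Monotone fun t => f t * Real.exp (G t) := by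
    refine monotone_of_hasDerivAt_nonneg (fun t => (hf t).mul (hGd t).exp) fun t => ?_
    have := (abs_le.1 (hfg t)).1
    have := Real.exp_pos (G t)
    simp only [Pi.zero_apply]
    nlinarith
  rcases le_total s t with h | h
  · calc f t = f t * Real.exp (-G t) * Real.exp (G t) := by
          rw [mul_assoc, ← Real.exp_add]; simp
      _ ≤ f s * Real.exp (-G s) * Real.exp (G t) :=
          mul_le_mul_of_nonneg_right (hanti h) (Real.exp_pos _).le
      _ = f s * Real.exp (G t - G s) := by rw [mul_assoc, ← Real.exp_add]; ring_nf
      _ ≤ _ := by gcongr; exacts [hf0 s, hGle s t h]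
  · calc f t = f t * Real.exp (G t) * Real.exp (-G t) := by
          rw [mul_assoc, ← Real.exp_add]; simp
      _ ≤ f s * Real.exp (G s) * Real.exp (-G t) :=
          mul_le_mul_of_nonneg_right (hmono h) (Real.exp_pos _).le
      _ = f s * Real.exp (G s - G t) := by rw [mul_assoc, ← Real.exp_add]; ring_nf
      _ ≤ _ := by gcongr; exacts [hf0 s, hGle t s h]

/-- The quadratic form of `i A` has real part controlled by the antiselfadjoint part of `A`. -/
theorem abs_two_mul_re_inner_I_smul_le {E : Type*} [NormedAddCommGroup E]
    [InnerProductSpace ℂ E] [CompleteSpace E] (A : E →L[ℂ] E) (u : E) :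
    |2 * (inner ℂ u (Complex.I • A u)).re| ≤
      ‖A - ContinuousLinearMap.adjoint A‖ * ‖u‖ ^ 2 := by
  have key : 2 * (inner ℂ u (Complex.I • A u)).re =
      (Complex.I * inner ℂ u ((A - ContinuousLinearMap.adjoint A) u)).re := by
    have h : inner ℂ u (ContinuousLinearMap.adjoint A u) =
        (starRingEnd ℂ) (inner ℂ u (A u)) := by
      rw [ContinuousLinearMap.adjoint_inner_right, inner_conj_symm]
    rw [sub_apply, inner_sub_right, h, inner_smul_right]
    simp [-inner_conj_symm]
    ring
  calc |2 * (inner ℂ u (Complex.I • A u)).re|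
      ≤ ‖Complex.I * inner ℂ u ((A - ContinuousLinearMap.adjoint A) u)‖ := by
        rw [key]; exact Complex.abs_re_le_norm _
    _ ≤ ‖u‖ * ‖(A - ContinuousLinearMap.adjoint A) u‖ := by
        rw [norm_mul, Complex.norm_I, one_mul]; exact norm_inner_le_norm _ _
    _ ≤ ‖u‖ * (‖A - ContinuousLinearMap.adjoint A‖ * ‖u‖) := by
        gcongr; exact ContinuousLinearMap.le_opNorm _ _
    _ = _ := by ring

/-- If `U` is the Cauchy evolution generated by a norm-continuous
`H : ℝ → B(𝓗)` and `‖H(t) − H(t)*‖ ≤ C·⟨t⟩^(−1−δ)` for some `C ≥ 0`, `δ > 0`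
(where `⟨t⟩ = (1+t²)^(1/2)`), then `sup_{t,s} ‖U(t,s)‖ < ∞`. -/
theorem stmt2 {𝓗 : Type*} [NormedAddCommGroup 𝓗] [InnerProductSpace ℂ 𝓗] [CompleteSpace 𝓗]
    (H : ℝ → (𝓗 →L[ℂ] 𝓗)) (hH : Continuous H)
    (U : ℝ → ℝ → (𝓗 →L[ℂ] 𝓗))
    (hU1 : ∀ t, U t t = 1)
    (hU2 : ∀ s t, HasDerivAt (fun τ => U τ s) (Complex.I • (H t * U t s)) t)
    (hU3 : ∀ t s, HasDerivAt (fun σ => U t σ) (-(Complex.I • (U t s * H s))) s)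
    (C δ : ℝ) (hC : 0 ≤ C) (hδ : 0 < δ)
    (hsa : ∀ t, ‖H t - ContinuousLinearMap.adjoint (H t)‖ ≤
      C * (1 + t ^ 2) ^ (-(1 + δ) / 2 : ℝ)) :
    ∃ M : ℝ, ∀ t s, ‖U t s‖ ≤ M := by
  set g : ℝ → ℝ := fun t => C * (1 + t ^ 2) ^ (-(1 + δ) / 2 : ℝ) with hgdef
  have hg : Continuous g := continuous_const.mul <|
    (by fun_prop : Continuous fun t : ℝ => 1 + t ^ 2).rpow_const fun t => Or.inl (by positivity)
  have hgi : MeasureTheory.Integrable g := by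
    have h := integrable_rpow_neg_one_add_norm_sq (E := ℝ) (μ := MeasureTheory.volume)
      (r := 1 + δ) (by simpa using hδ)
    simpa [hgdef] using h.const_mul C
  have hg0 : ∀ t, 0 ≤ g t := fun t => by positivity
  refine ⟨Real.exp (∫ x, g x), fun t s => ContinuousLinearMap.opNorm_le_bound _
    (Real.exp_pos _).le fun x => ?_⟩
  have hd : ∀ τ, HasDerivAt (fun τ => ‖U τ s x‖ ^ 2)
      (2 * (inner ℂ (U τ s x) (Complex.I • H τ (U τ s x))).re) τ := fun τ => by
    let _ : InnerProductSpace ℝ 𝓗 := InnerProductSpace.rclikeToReal ℂ 𝓗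
    have h1 : HasDerivAt (fun τ => U τ s x) (Complex.I • H τ (U τ s x)) τ := by
      simpa [Function.comp_def] using ((ContinuousLinearMap.apply ℂ 𝓗 x).restrictScalars
        ℝ).hasFDerivAt.comp_hasDerivAt τ (hU2 s τ)
    exact h1.norm_sq
  have hgron := le_mul_exp_integral_of_abs_deriv_le hg hgi hd (fun _ => by positivity)
    (fun τ => (abs_two_mul_re_inner_I_smul_le _ _).trans <|
      mul_le_mul_of_nonneg_right (hsa τ) (by positivity)) hg0 s t
  have hI : 1 ≤ Real.exp (∫ x, g x) :=
    Real.one_le_exp (MeasureTheory.integral_nonneg hg0)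
  rw [hU1, one_apply_eq_self] at hgron
  refine (sq_le_sq₀ (norm_nonneg _) (by positivity)).1 ?_
  calc ‖U t s x‖ ^ 2 ≤ ‖x‖ ^ 2 * Real.exp (∫ x, g x) := hgron
    _ ≤ ‖x‖ ^ 2 * Real.exp (∫ x, g x) ^ 2 := by gcongr; exact le_self_pow₀ hI two_ne_zero
    _ = _ := by ring
end

section
/- Let 𝓗 be a complex Hilbert space, H : ℝ → B(𝓗) norm-continuous, and U the Cauchy evolution generated by H, and assume M := sup_{t,s ∈ ℝ}‖U(t,s)‖ < ∞. Let A : ℝ → B(𝓗) be continuously differentiable in operator norm with A(t) invertible for every t, and suppose there are C ≥ 0 and δ > 0 such that ‖(A'(t) − i[H(t), A(t)])·A(t)^{−1}‖ ≤ C·⟨t⟩^{−1−δ} for all t ∈ ℝ, where [H,A] = HA − AH. Then sup_{t ∈ ℝ} ‖U(0,t)·A(t)·U(t,0)·A(0)^{−1}‖ < ∞. -/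
/-- A Gronwall estimate with an integrable coefficient, forward in time. -/
theorem norm_le_mul_exp_integral_of_nonneg {E : Type*} [NormedAddCommGroup E] [NormedSpace ℝ E]
    {f f' : ℝ → E} {k : ℝ → ℝ} (hf : ∀ t, HasDerivAt f (f' t) t) (hk : Continuous k)
    (hk0 : ∀ t, 0 < k t) (hki : MeasureTheory.Integrable k)
    (hbound : ∀ t, ‖f' t‖ ≤ k t * ‖f t‖) {t : ℝ} (ht : 0 ≤ t) :
    ‖f t‖ ≤ (‖f 0‖ + 1) * Real.exp (2 * ∫ s, k s) := by
  set B : ℝ → ℝ := fun x => (‖f 0‖ + 1) * Real.exp (2 * ∫ s in (0 : ℝ)..x, k s) with hB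
  have hBpos : ∀ x, 0 < B x := fun x => by positivity
  have hBderiv : ∀ x, HasDerivAt B (2 * k x * B x) x := fun x => by
    have h := ((((hk.integral_hasStrictDerivAt 0 x).hasDerivAt).const_mul 2).exp).const_mul
      (‖f 0‖ + 1)
    refine h.congr_deriv ?_
    simp only [hB]
    ring
  have hfB : ‖f t‖ ≤ B t := by
    refine image_norm_le_of_norm_deriv_right_lt_deriv_boundary (a := 0) (b := t)
      (fun x _ => (hf x).continuousAt.continuousWithinAt)
      (fun x _ => (hf x).hasDerivWithinAt) ?_ hBderiv ?_ ⟨ht, le_rfl⟩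
    · simp [hB]
    · intro x _ hx
      have h := hbound x
      rw [hx] at h
      have := mul_pos (hk0 x) (hBpos x)
      linarith
  refine hfB.trans ?_
  have hint : ∫ s in (0 : ℝ)..t, k s ≤ ∫ s, k s := by
    rw [intervalIntegral.integral_of_le ht]
    exact MeasureTheory.setIntegral_le_integral hki (.of_forall fun s => (hk0 s).le)
  simp only [hB]
  gcongr

/-- A Gronwall estimate with an integrable coefficient on the whole line. -/
theorem norm_le_mul_exp_integral {E : Type*} [NormedAddCommGroup E] [NormedSpace ℝ E]
    {f f' : ℝ → E} {k : ℝ → ℝ} (hf : ∀ t, HasDerivAt f (f' t) t) (hk : Continuous k)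
    (hk0 : ∀ t, 0 < k t) (hki : MeasureTheory.Integrable k)
    (hbound : ∀ t, ‖f' t‖ ≤ k t * ‖f t‖) (t : ℝ) :
    ‖f t‖ ≤ (‖f 0‖ + 1) * Real.exp (2 * ∫ s, k s) := by
  rcases le_total 0 t with ht | ht
  · exact norm_le_mul_exp_integral_of_nonneg hf hk hk0 hki hbound ht
  · have h := norm_le_mul_exp_integral_of_nonneg (f := fun s => f (-s)) (f' := fun s => -f' (-s))
      (k := fun s => k (-s))
      (fun s => by simpa [Function.comp_def] using (hf (-s)).scomp s (hasDerivAt_neg s))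
      (hk.comp continuous_neg) (fun s => hk0 (-s)) hki.comp_neg
      (fun s => by simpa using hbound (-s)) (neg_nonneg.2 ht)
    simpa [MeasureTheory.integral_neg_eq_self k MeasureTheory.volume] using h

/-- The propagation law `U(t,s)U(s,r) = U(t,r)` of a Cauchy evolution. -/
theorem cauchyEvolution_mul {R : Type*} [NormedRing R] [NormedAlgebra ℂ R]
    {H : ℝ → R} {U : ℝ → ℝ → R} (hU1 : ∀ t, U t t = 1)
    (hU2 : ∀ s t, HasDerivAt (fun τ => U τ s) (Complex.I • (H t * U t s)) t)
    (hU3 : ∀ t s, HasDerivAt (fun σ => U t σ) (-(Complex.I • (U t s * H s))) s)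
    (t s r : ℝ) : U t s * U s r = U t r := by
  have hderiv : ∀ x, HasDerivAt (fun σ => U t σ * U σ r) 0 x := fun x => by
    refine ((hU3 t x).mul (hU2 r x)).congr_deriv ?_
    simp [mul_assoc]
  have h := is_const_of_deriv_eq_zero (fun x => (hderiv x).differentiableAt)
    (fun x => (hderiv x).deriv) s t
  simpa [hU1] using h


/-- Let `U` be the Cauchy evolution generated by a norm-continuous
`H : ℝ → B(𝓗)`, with `sup_{t,s}‖U(t,s)‖ < ∞`. Let `A : ℝ → B(𝓗)` be continuously
differentiable in operator norm with each `A(t)` invertible (with inverse `Ainv(t)`),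
and suppose `‖(A'(t) − i[H(t),A(t)])·A(t)⁻¹‖ ≤ C·⟨t⟩^(−1−δ)` for some `C ≥ 0`, `δ > 0`.
Then `sup_t ‖U(0,t)·A(t)·U(t,0)·A(0)⁻¹‖ < ∞`. -/
theorem stmt3 {𝓗 : Type*} [NormedAddCommGroup 𝓗] [InnerProductSpace ℂ 𝓗] [CompleteSpace 𝓗]
    (H : ℝ → (𝓗 →L[ℂ] 𝓗)) (hH : Continuous H)
    (U : ℝ → ℝ → (𝓗 →L[ℂ] 𝓗))
    (hU1 : ∀ t, U t t = 1)
    (hU2 : ∀ s t, HasDerivAt (fun τ => U τ s) (Complex.I • (H t * U t s)) t)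
    (hU3 : ∀ t s, HasDerivAt (fun σ => U t σ) (-(Complex.I • (U t s * H s))) s)
    (hM : ∃ M : ℝ, ∀ t s, ‖U t s‖ ≤ M)
    (A A' Ainv : ℝ → (𝓗 →L[ℂ] 𝓗))
    (hA : ∀ t, HasDerivAt A (A' t) t) (hA' : Continuous A')
    (hAinv : ∀ t, A t * Ainv t = 1 ∧ Ainv t * A t = 1)
    (C δ : ℝ) (hC : 0 ≤ C) (hδ : 0 < δ)
    (hdecay : ∀ t, ‖(A' t - Complex.I • (H t * A t - A t * H t)) * Ainv t‖ ≤
      C * (1 + t ^ 2) ^ (-(1 + δ) / 2 : ℝ)) :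
    ∃ M' : ℝ, ∀ t, ‖U 0 t * A t * U t 0 * Ainv 0‖ ≤ M' := by
  obtain ⟨M, hM⟩ := hM
  have hM0 : 0 ≤ M := (norm_nonneg _).trans (hM 0 0)
  have hUU : ∀ t, U t 0 * U 0 t = 1 := fun t => by
    rw [cauchyEvolution_mul hU1 hU2 hU3, hU1]
  set G : ℝ → (𝓗 →L[ℂ] 𝓗) :=
    fun t => (A' t - Complex.I • (H t * A t - A t * H t)) * Ainv t with hG
  set B : ℝ → (𝓗 →L[ℂ] 𝓗) := fun t => U 0 t * A t * U t 0 * Ainv 0 with hBdef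
  have hB : ∀ t, HasDerivAt B (U 0 t * G t * U t 0 * B t) t := fun t => by
    refine ((((hU3 0 t).mul (hA t)).mul (hU2 0 t)).mul_const (Ainv 0)).congr_deriv ?_
    have hcancel : U 0 t * G t * U t 0 * B t =
        U 0 t * (A' t - Complex.I • (H t * A t - A t * H t)) * (Ainv t * ((U t 0 * U 0 t) * A t)) *
          U t 0 * Ainv 0 := by
      simp only [hG, hBdef, mul_assoc]
    rw [hcancel, hUU, one_mul, (hAinv t).2, mul_one]
    simp only [mul_sub, sub_mul, add_mul, smul_sub, mul_smul_comm, smul_mul_assoc, neg_mul,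
      mul_assoc]
    abel
  refine ⟨_, norm_le_mul_exp_integral
    (k := fun t => (M * C * M + 1) * (1 + t ^ 2) ^ (-(1 + δ) / 2 : ℝ)) hB ?_ ?_ ?_ ?_⟩
  · refine continuous_const.mul (Continuous.rpow_const (by fun_prop) fun t => Or.inl ?_)
    positivity
  · intro t
    positivity
  · have h := integrable_rpow_neg_one_add_norm_sq (E := ℝ) (μ := MeasureTheory.volume)
      (r := 1 + δ) (by simpa using hδ)
    simp only [Real.norm_eq_abs, sq_abs] at h
    exact h.const_mul _
  · intro t
    have hw : 0 ≤ (1 + t ^ 2) ^ (-(1 + δ) / 2 : ℝ) := by positivity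
    calc ‖U 0 t * G t * U t 0 * B t‖ ≤ ‖U 0 t‖ * ‖G t‖ * ‖U t 0‖ * ‖B t‖ :=
          (norm_mul_le _ _).trans (by gcongr; exact norm_mul₃_le)
      _ ≤ M * (C * (1 + t ^ 2) ^ (-(1 + δ) / 2 : ℝ)) * M * ‖B t‖ := by
          gcongr
          exacts [hM _ _, hdecay t, hM _ _]
      _ ≤ (M * C * M + 1) * (1 + t ^ 2) ^ (-(1 + δ) / 2 : ℝ) * ‖B t‖ := by
          refine mul_le_mul_of_nonneg_right ?_ (norm_nonneg _)
          linarith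
end

section
/- Let 𝓗 be a complex Hilbert space, let H, K : ℝ → B(𝓗) be norm-continuous, and let U_H, U_K be the Cauchy evolutions generated by H and K respectively. Then for all t, s ∈ ℝ, U_H(t,s) − U_K(t,s) = i·∫_s^t U_H(t,σ)·(H(σ) − K(σ))·U_K(σ,s) dσ, where the integral is a Bochner integral in operator norm. -/
/-- If `U_H`, `U_K` are the Cauchy evolutions generated by the
norm-continuous families `H, K : ℝ → B(𝓗)`, then for all `t, s`:
`U_H(t,s) − U_K(t,s) = i·∫_s^t U_H(t,σ)·(H(σ) − K(σ))·U_K(σ,s) dσ`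
(a Bochner integral in operator norm). -/
theorem stmt5 {𝓗 : Type*} [NormedAddCommGroup 𝓗] [InnerProductSpace ℂ 𝓗] [CompleteSpace 𝓗]
    (H K : ℝ → (𝓗 →L[ℂ] 𝓗)) (hH : Continuous H) (hK : Continuous K)
    (UH UK : ℝ → ℝ → (𝓗 →L[ℂ] 𝓗))
    (hUH1 : ∀ t, UH t t = 1)
    (hUH2 : ∀ s t, HasDerivAt (fun τ => UH τ s) (Complex.I • (H t * UH t s)) t)
    (hUH3 : ∀ t s, HasDerivAt (fun σ => UH t σ) (-(Complex.I • (UH t s * H s))) s)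
    (hUK1 : ∀ t, UK t t = 1)
    (hUK2 : ∀ s t, HasDerivAt (fun τ => UK τ s) (Complex.I • (K t * UK t s)) t)
    (hUK3 : ∀ t s, HasDerivAt (fun σ => UK t σ) (-(Complex.I • (UK t s * K s))) s) :
    ∀ t s : ℝ, UH t s - UK t s =
      Complex.I • ∫ σ in s..t, UH t σ * (H σ - K σ) * UK σ s := by
  intro t s
  have hderiv : ∀ σ, HasDerivAt (fun σ => UH t σ * UK σ s)
      (-(Complex.I • (UH t σ * (H σ - K σ) * UK σ s))) σ := by
    intro σ
    refine ((hUH3 t σ).mul (hUK2 s σ)).congr_deriv ?_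
    simp only [mul_sub, sub_mul, neg_mul, smul_mul_assoc, mul_smul_comm, smul_sub, mul_assoc]
    abel
  have hUHc : Continuous fun σ => UH t σ :=
    continuous_iff_continuousAt.2 fun σ => (hUH3 t σ).continuousAt
  have hUKc : Continuous fun σ => UK σ s :=
    continuous_iff_continuousAt.2 fun σ => (hUK2 s σ).continuousAt
  have hcont : Continuous fun σ => -(Complex.I • (UH t σ * (H σ - K σ) * UK σ s)) :=
    (((hUHc.mul (hH.sub hK)).mul hUKc).const_smul Complex.I).neg
  have hint := intervalIntegral.integral_eq_sub_of_hasDerivAt (a := s) (b := t)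
    (fun σ _ => hderiv σ) (hcont.intervalIntegrable s t)
  rw [intervalIntegral.integral_neg, intervalIntegral.integral_smul, hUH1, hUK1, one_mul, mul_one,
    neg_eq_iff_eq_neg, neg_sub] at hint
  exact hint.symm
end

section
/- Let 𝓗 be a complex Hilbert space. Let b⁺, b⁻ : ℝ → B(𝓗) be continuously differentiable in operator norm, let a, r, ρ⁺, ρ⁻ : ℝ → B(𝓗), and suppose that for both signs the Riccati identity i·(b^±)'(t) − b^±(t)² + a(t) + i·r(t)·b^±(t) = ρ^±(t) holds for all t, and that ε(t) := b⁺(t) − b⁻(t) is invertible for every t. Let φ : ℝ → 𝓗 be twice differentiable with φ''(t) + r(t)·φ'(t) + a(t)·φ(t) = 0 for all t, and set ψ₁(t) := φ'(t) − i·b⁻(t)·φ(t) and ψ₂(t) := φ'(t) − i·b⁺(t)·φ(t). Then for all t: ψ₁'(t) = i·(−b⁻(t) + i·r(t))·ψ₁(t) + i·ρ⁻(t)·ε(t)^{−1}·(ψ₁(t) − ψ₂(t)) and ψ₂'(t) = i·(−b⁺(t) + i·r(t))·ψ₂(t) + i·ρ⁺(t)·ε(t)^{−1}·(ψ₁(t)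 − ψ₂(t)). In particular (ψ₁, ψ₂) solves a first-order system whose generator is diagonal up to the terms involving ρ^±. -/
/-- The product rule for a real curve of complex-linear operators applied to a curve of vectors. -/
theorem HasDerivAt.complex_clm_apply {E F : Type*} [NormedAddCommGroup E] [NormedSpace ℂ E]
    [NormedAddCommGroup F] [NormedSpace ℂ F] {b : ℝ → (E →L[ℂ] F)} {b' : E →L[ℂ] F}
    {φ : ℝ → E} {φ' : E} {t : ℝ} (hb : HasDerivAt b b' t) (hφ : HasDerivAt φ φ' t) :
    HasDerivAt (fun τ => b τ (φ τ)) (b' (φ t) + b t φ') t :=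
  ((ContinuousLinearMap.restrictScalarsL ℂ E F ℝ ℝ).hasFDerivAt.comp_hasDerivAt t hb).clm_apply hφ

/-- An approximate solution `b` of the operator Riccati equation, with defect `ρ`, factorizes
`φ'' + r φ' + a φ = 0` into a first-order equation for `φ' - i b φ`, up to the term `ρ φ`. -/
theorem hasDerivAt_sub_I_smul_of_riccati {E : Type*} [NormedAddCommGroup E] [NormedSpace ℂ E]
    {b : ℝ → (E →L[ℂ] E)} {b' a r ρ : E →L[ℂ] E} {φ φ' : ℝ → E} {φ'' : E} {t : ℝ}
    (hb : HasDerivAt b b' t)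
    (hric : Complex.I • b' - b t * b t + a + Complex.I • (r * b t) = ρ)
    (hφ : HasDerivAt φ (φ' t) t) (hφ' : HasDerivAt φ' φ'' t)
    (hode : φ'' + r (φ' t) + a (φ t) = 0) :
    HasDerivAt (fun τ => φ' τ - Complex.I • b τ (φ τ))
      (Complex.I • ((-b t + Complex.I • r) (φ' t - Complex.I • b t (φ t))) - ρ (φ t)) t := by
  refine (hφ'.sub ((hb.complex_clm_apply hφ).const_smul Complex.I)).congr_deriv ?_
  rw [← hric, show φ'' = -r (φ' t) - a (φ t) by rw [← sub_eq_zero, ← hode]; abel]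
  simp only [add_apply, sub_apply, neg_apply, smul_apply, mul_apply_eq_comp, map_sub,
    map_smul]
  match_scalars <;> ring_nf <;> simp

/-- The vector `φ` is recovered, up to the factor `i`, from the difference of the two
first-order unknowns. -/
theorem ringInverse_sub_apply_sub {E : Type*} [NormedAddCommGroup E] [NormedSpace ℂ E]
    {p m : E →L[ℂ] E} (h : IsUnit (p - m)) (u v : E) :
    Ring.inverse (p - m) ((v - Complex.I • m u) - (v - Complex.I • p u)) = Complex.I • u := by
  have huv : (v - Complex.I • m u) - (v - Complex.I • p u) = Complex.I • (p - m) u := by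
    rw [sub_apply, smul_sub]
    abel
  have hinv := DFunLike.congr_fun (Ring.inverse_mul_cancel _ h) u
  rw [huv, map_smul]
  exact congrArg (Complex.I • ·) hinv

/-- Suppose `b⁺, b⁻ : ℝ → B(𝓗)` are continuously differentiable, both
satisfy the Riccati identity `i·(b^±)' − (b^±)² + a + i·r·b^± = ρ^±`, and
`ε(t) := b⁺(t) − b⁻(t)` is invertible for every `t`. If `φ : ℝ → 𝓗` is twice
differentiable with `φ'' + r·φ' + a·φ = 0`, and `ψ₁ := φ' − i·b⁻·φ`, `ψ₂ := φ' − i·b⁺·φ`,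
then `ψ₁' = i·(−b⁻ + i·r)·ψ₁ + i·ρ⁻·ε⁻¹·(ψ₁ − ψ₂)` and
`ψ₂' = i·(−b⁺ + i·r)·ψ₂ + i·ρ⁺·ε⁻¹·(ψ₁ − ψ₂)`: the pair `(ψ₁, ψ₂)` solves a first-order
system whose generator is diagonal up to the terms involving `ρ^±`. -/
theorem stmt11 {𝓗 : Type*} [NormedAddCommGroup 𝓗] [InnerProductSpace ℂ 𝓗] [CompleteSpace 𝓗]
    (bp bp' bm bm' a r ρp ρm : ℝ → (𝓗 →L[ℂ] 𝓗))
    (hbp : ∀ t, HasDerivAt bp (bp' t) t) (hbp' : Continuous bp')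
    (hbm : ∀ t, HasDerivAt bm (bm' t) t) (hbm' : Continuous bm')
    (hricp : ∀ t, Complex.I • bp' t - bp t * bp t + a t + Complex.I • (r t * bp t) = ρp t)
    (hricm : ∀ t, Complex.I • bm' t - bm t * bm t + a t + Complex.I • (r t * bm t) = ρm t)
    (hε : ∀ t, IsUnit (bp t - bm t))
    (φ φ' φ'' : ℝ → 𝓗)
    (hφ : ∀ t, HasDerivAt φ (φ' t) t) (hφ' : ∀ t, HasDerivAt φ' (φ'' t) t)
    (hKG : ∀ t, φ'' t + (r t) (φ' t) + (a t) (φ t) = 0) :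
    ∀ t : ℝ,
      HasDerivAt (fun τ => φ' τ - Complex.I • (bm τ) (φ τ))
        (Complex.I • ((-bm t + Complex.I • r t) (φ' t - Complex.I • (bm t) (φ t)))
          + Complex.I • ((ρm t) ((Ring.inverse (bp t - bm t))
              ((φ' t - Complex.I • (bm t) (φ t)) - (φ' t - Complex.I • (bp t) (φ t)))))) t ∧
      HasDerivAt (fun τ => φ' τ - Complex.I • (bp τ) (φ τ))
        (Complex.I • ((-bp t + Complex.I • r t) (φ' t - Complex.I • (bp t) (φ t)))
          + Complex.I • ((ρp t) ((Ring.inverse (bp t - bm t))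
              ((φ' t - Complex.I • (bm t) (φ t)) - (φ' t - Complex.I • (bp t) (φ t)))))) t := by
  intro t
  simp only [ringInverse_sub_apply_sub (hε t), map_smul, smul_smul, Complex.I_mul_I, neg_one_smul,
    ← sub_eq_add_neg]
  exact ⟨hasDerivAt_sub_I_smul_of_riccati (hbm t) (hricm t) (hφ t) (hφ' t) (hKG t),
    hasDerivAt_sub_I_smul_of_riccati (hbp t) (hricp t) (hφ t) (hφ' t) (hKG t)⟩
end

section
/- Let δ ∈ ℝ and let (m_j)_{j∈ℕ} be a strictly decreasing sequence of real numbers with m_j → −∞. For each j let a_j ∈ S^{m_j,δ}_td. Then there exists a ∈ S^{m_0,δ}_td such that for every N ∈ ℕ, a − Σ_{j=0}^{N} a_j ∈ S^{m_{N+1},δ}_td; moreover a is unique modulo ⋂_{m∈ℝ} S^{m,δ}_td (i.e. if a' has the same property then a − a' ∈ S^{m,δ}_td for every m ∈ ℝ). -/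
noncomputable section

/-- Directional derivative of `f` along the vector `v`. -/
def pdir {E F : Type*} [NormedAddCommGroup E] [NormedSpace ℝ E]
    [NormedAddCommGroup F] [NormedSpace ℝ F] (v : E) (f : E → F) : E → F :=
  fun x => fderiv ℝ f x v

/-- Multi-index iterated directional derivative: apply `(α j)`-fold differentiation along
`e j` for each `j`. -/
def pmulti {E F : Type*} [NormedAddCommGroup E] [NormedSpace ℝ E]
    [NormedAddCommGroup F] [NormedSpace ℝ F] {d : ℕ}
    (e : Fin d → E) (α : Fin d → ℕ) (f : E → F) : E → F :=
  (List.finRange d).foldr (fun j g => (pdir (e j))^[α j] g) f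

/-- The `t`-direction in `ℝ × ℝ^d × ℝ^d`. -/
def dirT (d : ℕ) : ℝ × EuclideanSpace ℝ (Fin d) × EuclideanSpace ℝ (Fin d) := (1, 0, 0)

/-- The `x_j`-directions in `ℝ × ℝ^d × ℝ^d`. -/
def dirX (d : ℕ) (j : Fin d) : ℝ × EuclideanSpace ℝ (Fin d) × EuclideanSpace ℝ (Fin d) :=
  (0, EuclideanSpace.single j 1, 0)

/-- The `k_j`-directions in `ℝ × ℝ^d × ℝ^d`. -/
def dirK (d : ℕ) (j : Fin d) : ℝ × EuclideanSpace ℝ (Fin d) × EuclideanSpace ℝ (Fin d) :=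
  (0, 0, EuclideanSpace.single j 1)

/-- The time-decaying symbol class `S^{m,δ}_td`: smooth functions `a(t,x,k)` on
`ℝ × ℝ^d × ℝ^d` such that for all `γ ∈ ℕ` and multi-indices `α, β ∈ ℕ^d` there is `C` with
`|∂ₜ^γ ∂ₓ^α ∂ₖ^β a(t,x,k)| ≤ C·⟨t⟩^(δ−γ)·⟨k⟩^(m−|β|)`. -/
def SymbTD (d : ℕ) (m δ : ℝ)
    (a : ℝ × EuclideanSpace ℝ (Fin d) × EuclideanSpace ℝ (Fin d) → ℂ) : Prop :=
  ContDiff ℝ (⊤ : ℕ∞) a ∧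
  ∀ (γ : ℕ) (α β : Fin d → ℕ), ∃ C : ℝ,
    ∀ p : ℝ × EuclideanSpace ℝ (Fin d) × EuclideanSpace ℝ (Fin d),
      ‖(pdir (dirT d))^[γ] (pmulti (dirX d) α (pmulti (dirK d) β a)) p‖ ≤
        C * (1 + p.1 ^ 2) ^ ((δ - (γ : ℝ)) / 2) *
          (1 + ‖p.2.2‖ ^ 2) ^ ((m - ∑ j, (β j : ℝ)) / 2)

open scoped ContDiff Topology

/-- The phase space `ℝ × ℝ^d × ℝ^d`. -/
abbrev Phase (d : ℕ) := ℝ × EuclideanSpace ℝ (Fin d) × EuclideanSpace ℝ (Fin d)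

/-- Labels of the coordinate directions: `none` is `t`, `(false, j)` is `x_j`, `(true, j)` is `k_j`. -/
abbrev Dir (d : ℕ) := Option (Bool × Fin d)

/-- The vector of a coordinate direction. -/
def dirVec {d : ℕ} : Dir d → Phase d
  | none => dirT d
  | some (false, j) => dirX d j
  | some (true, j) => dirK d j

/-- Order of a coordinate derivative in `t`. -/
def tOrd {d : ℕ} : Dir d → ℝ
  | none => 1
  | some _ => 0

/-- Order of a coordinate derivative in `k`. -/
def kOrd {d : ℕ} : Dir d → ℝ
  | some (true, _) => 1
  | _ => 0

/-- Iterated coordinate derivative along a word of directions; the head is applied first. -/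
def wordDeriv {d : ℕ} (w : List (Dir d)) (f : Phase d → ℂ) : Phase d → ℂ :=
  w.foldl (fun g v => pdir (dirVec v) g) f

/-- The weight bounding the derivative along `w` of a symbol of order `(m, δ)`. -/
def symbWeight {d : ℕ} (m δ : ℝ) (w : List (Dir d)) (p : Phase d) : ℝ :=
  (1 + p.1 ^ 2) ^ ((δ - (w.map tOrd).sum) / 2) *
    (1 + ‖p.2.2‖ ^ 2) ^ ((m - (w.map kOrd).sum) / 2)

/-- Families of symbols of order `(m, δ)` bounded uniformly in the index. -/
def UnifSymb {d : ℕ} {ι : Type*} (m δ : ℝ) (f : ι → Phase d → ℂ) : Prop :=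
  (∀ i, ContDiff ℝ ∞ (f i)) ∧
    ∀ w, ∃ C : ℝ, ∀ i p, ‖wordDeriv w (f i) p‖ ≤ C * symbWeight m δ w p

section Derivatives

variable {E F : Type*} [NormedAddCommGroup E] [NormedSpace ℝ E]
  [NormedAddCommGroup F] [NormedSpace ℝ F]

lemma ContDiff.pdir {f : E → F} (hf : ContDiff ℝ ∞ f) (v : E) : ContDiff ℝ ∞ (pdir v f) :=
  (hf.fderiv_right (m := ∞) (by simp)).clm_apply contDiff_const

lemma pdir_comm {f : E → F} (hf : ContDiff ℝ ∞ f) (u v : E) :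
    pdir u (pdir v f) = pdir v (pdir u f) := by
  have hd : Differentiable ℝ (fderiv ℝ f) :=
    (hf.fderiv_right (m := ∞) (by simp)).differentiable (by simp)
  have key : ∀ (a b : E) (x : E), pdir a (pdir b f) x = fderiv ℝ (fderiv ℝ f) x a b := by
    intro a b x
    unfold _root_.pdir
    rw [fderiv_clm_apply (hd x) (differentiableAt_const b)]
    simp
  funext x
  rw [key, key]
  refine (hf.contDiffAt.isSymmSndFDerivAt ?_).eq u v
  simp only [minSmoothness_of_isRCLikeNormedField]
  exact WithTop.coe_le_coe.2 le_top

lemma pdir_add {f g : E → F} (hf : ContDiff ℝ ∞ f) (hg : ContDiff ℝ ∞ g) (v : E) :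
    pdir v (f + g) = pdir v f + pdir v g := by
  funext x
  simp [pdir, fderiv_add (hf.differentiable (by simp) x) (hg.differentiable (by simp) x)]

lemma pdir_mul {f g : E → ℂ} (hf : ContDiff ℝ ∞ f) (hg : ContDiff ℝ ∞ g) (v : E) :
    pdir v (f * g) = pdir v f * g + f * pdir v g := by
  funext x
  simp only [pdir, Pi.add_apply, Pi.mul_apply,
    fderiv_mul (hf.differentiable (by simp) x) (hg.differentiable (by simp) x)]
  simp
  ring

lemma pdir_const (c : F) (v : E) : pdir v (fun _ : E => c) = 0 := by
  funext x
  simp [pdir]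

lemma pdir_zero_fun (v : E) : pdir v (0 : E → F) = 0 := pdir_const 0 v

end Derivatives

section Words

variable {d : ℕ}

@[simp] lemma wordDeriv_nil (f : Phase d → ℂ) : wordDeriv [] f = f := rfl

@[simp] lemma wordDeriv_cons (v : Dir d) (w : List (Dir d)) (f : Phase d → ℂ) :
    wordDeriv (v :: w) f = wordDeriv w (pdir (dirVec v) f) := rfl

lemma wordDeriv_append (u w : List (Dir d)) (f : Phase d → ℂ) :
    wordDeriv (u ++ w) f = wordDeriv w (wordDeriv u f) := by
  simp [wordDeriv, List.foldl_append]

lemma wordDeriv_replicate (n : ℕ) (v : Dir d) (f : Phase d → ℂ) :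
    wordDeriv (List.replicate n v) f = (pdir (dirVec v))^[n] f := by
  induction n generalizing f with
  | zero => rfl
  | succ n ih => rw [List.replicate_succ, wordDeriv_cons, ih, Function.iterate_succ_apply]

lemma wordDeriv_add (w : List (Dir d)) {f g : Phase d → ℂ} (hf : ContDiff ℝ ∞ f)
    (hg : ContDiff ℝ ∞ g) : wordDeriv w (f + g) = wordDeriv w f + wordDeriv w g := by
  induction w generalizing f g with
  | nil => rfl
  | cons v w ih =>
    rw [wordDeriv_cons, pdir_add hf hg, ih (hf.pdir _) (hg.pdir _)]
    rfl

lemma wordDeriv_zero (w : List (Dir d)) : wordDeriv w (0 : Phase d → ℂ) = 0 := by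
  induction w with
  | nil => rfl
  | cons v w ih => rw [wordDeriv_cons, pdir_zero_fun, ih]

lemma wordDeriv_sum {ι : Type*} (w : List (Dir d)) (s : Finset ι) {f : ι → Phase d → ℂ}
    (hf : ∀ i, ContDiff ℝ ∞ (f i)) :
    wordDeriv w (∑ i ∈ s, f i) = ∑ i ∈ s, wordDeriv w (f i) := by
  classical
  induction s using Finset.induction_on with
  | empty => simpa using wordDeriv_zero w
  | insert i s hi ih =>
    have hs : ContDiff ℝ ∞ (∑ i ∈ s, f i) := by
      rw [show (∑ i ∈ s, f i) = fun p => ∑ i ∈ s, f i p by ext; simp]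
      exact ContDiff.sum fun i _ => hf i
    rw [Finset.sum_insert hi, Finset.sum_insert hi, wordDeriv_add w (hf i) hs, ih]

lemma Filter.EventuallyEq.wordDeriv {f g : Phase d → ℂ} {p : Phase d} (h : f =ᶠ[𝓝 p] g)
    (w : List (Dir d)) : wordDeriv w f =ᶠ[𝓝 p] wordDeriv w g := by
  induction w generalizing f g with
  | nil => exact h
  | cons v w ih =>
    refine ih ?_
    filter_upwards [h.fderiv (𝕜 := ℝ)] with q hq
    simp [pdir, hq]

lemma wordDeriv_perm {w w' : List (Dir d)} (h : w.Perm w') {f : Phase d → ℂ}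
    (hf : ContDiff ℝ ∞ f) : wordDeriv w f = wordDeriv w' f := by
  induction h generalizing f with
  | nil => rfl
  | cons v _ ih => exact ih (hf.pdir _)
  | swap u v w => rw [wordDeriv_cons, wordDeriv_cons, pdir_comm hf]; rfl
  | trans _ _ ih₁ ih₂ => rw [ih₁ hf, ih₂ hf]

/-- The word listing the direction `c j` with multiplicity `α j` for every `j`. -/
def multiWord (c : Fin d → Dir d) (α : Fin d → ℕ) : List (Dir d) :=
  (List.finRange d).reverse.flatMap fun j => List.replicate (α j) (c j)

lemma wordDeriv_multiWord (c : Fin d → Dir d) (α : Fin d → ℕ) (f : Phase d → ℂ) :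
    wordDeriv (multiWord c α) f = pmulti (fun j => dirVec (c j)) α f := by
  unfold multiWord pmulti
  generalize List.finRange d = l
  induction l with
  | nil => rfl
  | cons j l ih =>
    simp only [List.reverse_cons, List.flatMap_append, wordDeriv_append, ih, List.foldr_cons]
    simp [wordDeriv_replicate]

lemma sum_map_multiWord (c : Fin d → Dir d) (α : Fin d → ℕ) (o : Dir d → ℝ) :
    ((multiWord c α).map o).sum = ∑ j, (α j : ℝ) * o (c j) := by
  unfold multiWord
  rw [Fin.sum_univ_def]
  generalize List.finRange d = l
  induction l with
  | nil => rfl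
  | cons j l ih =>
    simp only [List.reverse_cons, List.flatMap_append, List.map_append, List.sum_append, ih]
    simp [add_comm]

lemma count_multiWord (c : Fin d → Dir d) (α : Fin d → ℕ) (v : Dir d) :
    (multiWord c α).count v = ∑ j, if c j = v then α j else 0 := by
  unfold multiWord
  rw [Fin.sum_univ_def]
  generalize List.finRange d = l
  induction l with
  | nil => rfl
  | cons j l ih =>
    simp only [List.reverse_cons, List.flatMap_append, List.count_append, ih]
    simp [add_comm, List.count_replicate]

/-- The word of `∂ₜ^γ ∂ₓ^α ∂ₖ^β`. -/
def symbWord (γ : ℕ) (α β : Fin d → ℕ) : List (Dir d) :=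
  multiWord (fun j => some (true, j)) β ++
    (multiWord (fun j => some (false, j)) α ++ List.replicate γ none)

lemma wordDeriv_symbWord (γ : ℕ) (α β : Fin d → ℕ) (f : Phase d → ℂ) :
    wordDeriv (symbWord γ α β) f =
      (pdir (dirT d))^[γ] (pmulti (dirX d) α (pmulti (dirK d) β f)) := by
  simp only [symbWord, wordDeriv_append, wordDeriv_multiWord, wordDeriv_replicate]
  rfl

lemma symbWeight_symbWord (m δ : ℝ) (γ : ℕ) (α β : Fin d → ℕ) (p : Phase d) :
    symbWeight m δ (symbWord γ α β) p =
      (1 + p.1 ^ 2) ^ ((δ - (γ : ℝ)) / 2) *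
        (1 + ‖p.2.2‖ ^ 2) ^ ((m - ∑ j, (β j : ℝ)) / 2) := by
  simp [symbWeight, symbWord, sum_map_multiWord, tOrd, kOrd]

lemma perm_symbWord (w : List (Dir d)) :
    w.Perm (symbWord (w.count none) (fun j => w.count (some (false, j)))
      fun j => w.count (some (true, j))) := by
  rw [List.perm_iff_count]
  rintro (_ | ⟨_ | _, j⟩) <;>
  simp [symbWord, count_multiWord, List.count_replicate]

lemma symbWeight_perm (m δ : ℝ) {w w' : List (Dir d)} (h : w.Perm w') (p : Phase d) :
    symbWeight m δ w p = symbWeight m δ w' p := by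
  simp only [symbWeight, (h.map _).sum_eq]

lemma symbTD_iff {m δ : ℝ} {f : Phase d → ℂ} :
    SymbTD d m δ f ↔ UnifSymb m δ (fun _ : Unit => f) := by
  constructor
  · rintro ⟨hf, h⟩
    refine ⟨fun _ => hf, fun w => ?_⟩
    obtain ⟨C, hC⟩ := h (w.count none) (fun j => w.count (some (false, j)))
      (fun j => w.count (some (true, j)))
    refine ⟨C, fun _ p => ?_⟩
    rw [wordDeriv_perm (perm_symbWord w) hf, symbWeight_perm m δ (perm_symbWord w),
      wordDeriv_symbWord, symbWeight_symbWord, ← mul_assoc]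
    exact hC p
  · rintro ⟨hf, h⟩
    refine ⟨hf (), fun γ α β => ?_⟩
    obtain ⟨C, hC⟩ := h (symbWord γ α β)
    refine ⟨C, fun p => ?_⟩
    have := hC () p
    rwa [wordDeriv_symbWord, symbWeight_symbWord, ← mul_assoc] at this

end Words

section Classes

variable {d : ℕ} {ι : Type*} {m δ m' δ' : ℝ}

lemma symbWeight_nonneg (w : List (Dir d)) (p : Phase d) : 0 ≤ symbWeight m δ w p := by
  unfold symbWeight
  positivity

lemma symbWeight_mono (h : m ≤ m') (w : List (Dir d)) (p : Phase d) :
    symbWeight m δ w p ≤ symbWeight m' δ w p := by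
  unfold symbWeight
  gcongr
  nlinarith [sq_nonneg ‖p.2.2‖]

lemma symbWeight_cons (v : Dir d) (w : List (Dir d)) (p : Phase d) :
    symbWeight m δ (v :: w) p = symbWeight (m - kOrd v) (δ - tOrd v) w p := by
  simp only [symbWeight, List.map_cons, List.sum_cons, sub_sub]

lemma symbWeight_nil_mul (p : Phase d) :
    symbWeight m δ [] p * symbWeight m' δ' [] p = symbWeight (m + m') (δ + δ') [] p := by
  have h₁ : 0 < 1 + p.1 ^ 2 := by positivity
  have h₂ : 0 < 1 + ‖p.2.2‖ ^ 2 := by positivity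
  simp only [symbWeight, List.map_nil, List.sum_nil, sub_zero, add_div, Real.rpow_add h₁,
    Real.rpow_add h₂]
  ring

lemma UnifSymb.comp {κ : Type*} {f : ι → Phase d → ℂ} (hf : UnifSymb m δ f) (s : κ → ι) :
    UnifSymb m δ (fun i => f (s i)) :=
  ⟨fun _ => hf.1 _, fun w => (hf.2 w).imp fun _ hC _ => hC _⟩

lemma UnifSymb.mono {f : ι → Phase d → ℂ} (hf : UnifSymb m δ f) (h : m ≤ m') :
    UnifSymb m' δ f := by
  refine ⟨hf.1, fun w => ?_⟩
  obtain ⟨C, hC⟩ := hf.2 w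
  refine ⟨|C|, fun i p => (hC i p).trans ?_⟩
  exact mul_le_mul (le_abs_self C) (symbWeight_mono h w p) (symbWeight_nonneg w p) (abs_nonneg C)

lemma UnifSymb.pdir {f : ι → Phase d → ℂ} (hf : UnifSymb m δ f) (v : Dir d) :
    UnifSymb (m - kOrd v) (δ - tOrd v) (fun i => pdir (dirVec v) (f i)) := by
  refine ⟨fun i => (hf.1 i).pdir _, fun w => ?_⟩
  obtain ⟨C, hC⟩ := hf.2 (v :: w)
  exact ⟨C, fun i p => by rw [← symbWeight_cons]; exact hC i p⟩

lemma UnifSymb.add {f g : ι → Phase d → ℂ} (hf : UnifSymb m δ f) (hg : UnifSymb m δ g) :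
    UnifSymb m δ (fun i => f i + g i) := by
  refine ⟨fun i => (hf.1 i).add (hg.1 i), fun w => ?_⟩
  obtain ⟨C, hC⟩ := hf.2 w
  obtain ⟨D, hD⟩ := hg.2 w
  refine ⟨C + D, fun i p => ?_⟩
  rw [wordDeriv_add w (hf.1 i) (hg.1 i), add_mul]
  exact (norm_add_le _ _).trans (add_le_add (hC i p) (hD i p))

lemma UnifSymb.mul {f g : ι → Phase d → ℂ} (hf : UnifSymb m δ f) (hg : UnifSymb m' δ' g) :
    UnifSymb (m + m') (δ + δ') (fun i => f i * g i) := by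
  refine ⟨fun i => (hf.1 i).mul (hg.1 i), fun w => ?_⟩
  induction w generalizing f g m m' δ δ' with
  | nil =>
    obtain ⟨C, hC⟩ := hf.2 []
    obtain ⟨D, hD⟩ := hg.2 []
    refine ⟨C * D, fun i p => ?_⟩
    rw [← symbWeight_nil_mul, mul_mul_mul_comm]
    simp only [wordDeriv_nil, Pi.mul_apply, norm_mul]
    exact mul_le_mul (hC i p) (hD i p) (norm_nonneg _) ((norm_nonneg _).trans (hC i p))
  | cons v w ih =>
    obtain ⟨C, hC⟩ := ih (hf.pdir v) hg
    obtain ⟨D, hD⟩ := ih hf (hg.pdir v)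
    refine ⟨C + D, fun i p => ?_⟩
    have hl : ContDiff ℝ ∞ (_root_.pdir (dirVec v) (f i) * g i) := ((hf.1 i).pdir _).mul (hg.1 i)
    have hr : ContDiff ℝ ∞ (f i * _root_.pdir (dirVec v) (g i)) := (hf.1 i).mul ((hg.1 i).pdir _)
    rw [wordDeriv_cons, pdir_mul (hf.1 i) (hg.1 i), wordDeriv_add w hl hr, add_mul,
      symbWeight_cons]
    refine (norm_add_le _ _).trans (add_le_add ?_ ?_)
    · rw [add_sub_right_comm m, add_sub_right_comm δ]
      exact hC i p
    · rw [add_sub_assoc m, add_sub_assoc δ]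
      exact hD i p

lemma unifSymb_const (c : ℂ) : UnifSymb 0 0 (fun (_ : ι) (_ : Phase d) => c) := by
  refine ⟨fun _ => contDiff_const, fun w => ?_⟩
  cases w with
  | nil => exact ⟨‖c‖, fun i p => by simp [symbWeight]⟩
  | cons v w => exact ⟨0, fun i p => by simp [pdir_const, wordDeriv_zero]⟩

lemma UnifSymb.const_mul {f : ι → Phase d → ℂ} (hf : UnifSymb m δ f) (c : ℂ) :
    UnifSymb m δ (fun i p => c * f i p) := by
  have h := (unifSymb_const c).mul hf
  rwa [zero_add, zero_add] at h

lemma UnifSymb.sub {f g : ι → Phase d → ℂ} (hf : UnifSymb m δ f) (hg : UnifSymb m δ g) :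
    UnifSymb m δ (fun i => f i - g i) := by
  convert hf.add (hg.const_mul (-1)) using 2 with i
  ext p
  simp [sub_eq_add_neg]

lemma unifSymb_zero : UnifSymb m δ (fun _ : ι => (0 : Phase d → ℂ)) :=
  ⟨fun _ => contDiff_const, fun w => ⟨0, fun i p => by simp [wordDeriv_zero]⟩⟩

lemma UnifSymb.sum {κ : Type*} (s : Finset κ) {f : κ → ι → Phase d → ℂ}
    (hf : ∀ j ∈ s, UnifSymb m δ (f j)) : UnifSymb m δ (fun i => ∑ j ∈ s, f j i) := by
  classical
  induction s using Finset.induction_on with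
  | empty => simpa using unifSymb_zero
  | insert j s hj ih =>
    simp only [Finset.sum_insert hj]
    exact (hf j (by simp)).add (ih fun k hk => hf k (by simp [hk]))

end Classes

section Cutoff

variable {d : ℕ}

lemma unifSymb_scaled (n : ℕ) {ψ : EuclideanSpace ℝ (Fin d) → ℂ} (hψ : ContDiff ℝ ∞ ψ)
    (hc : HasCompactSupport ψ) :
    UnifSymb (-n : ℝ) 0 (fun (R : {R : ℝ // 1 ≤ R}) (p : Phase d) =>
      (((R : ℝ)⁻¹ ^ n : ℝ) : ℂ) * ψ ((R : ℝ)⁻¹ • p.2.2)) := by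
  have hsm : ∀ R : ℝ, ContDiff ℝ ∞ (fun p : Phase d => ψ (R⁻¹ • p.2.2)) := fun R =>
    hψ.comp (contDiff_snd.snd.const_smul _)
  refine ⟨fun R => contDiff_const.mul (hsm R), fun w => ?_⟩
  induction w generalizing n ψ with
  | nil =>
    obtain ⟨ρ, hρ⟩ := hc.isCompact.isBounded.exists_norm_le
    obtain ⟨B, hB⟩ := hψ.continuous.bounded_above_of_compact_support hc
    have hB0 : 0 ≤ B := (norm_nonneg _).trans (hB 0)
    refine ⟨B * (1 + ρ ^ 2) ^ ((n : ℝ) / 2), fun ⟨R, hR⟩ p => ?_⟩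
    have hR0 : 0 < R := by linarith
    by_cases hp : ψ (R⁻¹ • p.2.2) = 0
    · simp only [wordDeriv_nil, hp, mul_zero, norm_zero]
      exact mul_nonneg (by positivity) (symbWeight_nonneg _ _)
    have hk := hρ _ (subset_tsupport _ (Function.mem_support.2 hp))
    rw [norm_smul, norm_inv, Real.norm_of_nonneg hR0.le, inv_mul_le_iff₀ hR0] at hk
    have hk2 : 1 + ‖p.2.2‖ ^ 2 ≤ R ^ 2 * (1 + ρ ^ 2) := by
      nlinarith [pow_le_pow_left₀ (norm_nonneg _) hk 2]
    have h3 : (1 + ‖p.2.2‖ ^ 2) ^ ((n : ℝ) / 2) ≤ R ^ n * (1 + ρ ^ 2) ^ ((n : ℝ) / 2) := by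
      calc _ ≤ (R ^ 2 * (1 + ρ ^ 2)) ^ ((n : ℝ) / 2) := by gcongr
        _ = _ := by
          rw [Real.mul_rpow (by positivity) (by positivity), ← Real.rpow_natCast R 2,
            ← Real.rpow_mul hR0.le, ← Real.rpow_natCast R n]
          congr 2
          push_cast
          ring
    simp only [wordDeriv_nil, norm_mul, symbWeight, List.map_nil, List.sum_nil, sub_zero,
      zero_div, Real.rpow_zero, one_mul, neg_div, Complex.norm_real]
    rw [Real.norm_of_nonneg (by positivity), Real.rpow_neg (by positivity), ← div_eq_mul_inv,
      le_div_iff₀ (by positivity)]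
    calc R⁻¹ ^ n * ‖ψ (R⁻¹ • p.2.2)‖ * (1 + ‖p.2.2‖ ^ 2) ^ ((n : ℝ) / 2)
        ≤ R⁻¹ ^ n * B * (R ^ n * (1 + ρ ^ 2) ^ ((n : ℝ) / 2)) := by
          gcongr
          exact hB _
      _ = B * (1 + ρ ^ 2) ^ ((n : ℝ) / 2) := by
          rw [inv_pow]
          field_simp
  | cons v w ih =>
    have hder : ∀ R : ℝ, pdir (dirVec v) (fun p : Phase d =>
        ((R⁻¹ ^ n : ℝ) : ℂ) * ψ (R⁻¹ • p.2.2)) = fun p =>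
        ((R⁻¹ ^ (n + 1) : ℝ) : ℂ) * pdir (dirVec v).2.2 ψ (R⁻¹ • p.2.2) := by
      intro R
      funext p
      let L : Phase d →L[ℝ] EuclideanSpace ℝ (Fin d) :=
        R⁻¹ • (ContinuousLinearMap.snd ℝ _ _).comp (ContinuousLinearMap.snd ℝ _ _)
      have h1 : HasFDerivAt (fun p : Phase d => ψ (R⁻¹ • p.2.2))
          ((fderiv ℝ ψ (R⁻¹ • p.2.2)).comp L) p :=
        ((hψ.differentiable (by simp) _).hasFDerivAt).comp p L.hasFDerivAt
      have h2 := h1.const_mul ((R⁻¹ ^ n : ℝ) : ℂ)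
      simp only [pdir, h2.fderiv]
      simp [L, pow_succ, mul_assoc]
    have hzero : (dirVec v).2.2 = 0 → ∃ C : ℝ, ∀ (i : {R : ℝ // 1 ≤ R}) (p : Phase d),
        ‖wordDeriv (v :: w) (fun p : Phase d =>
          (((i : ℝ)⁻¹ ^ n : ℝ) : ℂ) * ψ ((i : ℝ)⁻¹ • p.2.2)) p‖ ≤
        C * symbWeight (-n : ℝ) 0 (v :: w) p := by
      intro h0
      refine ⟨0, fun i p => ?_⟩
      rw [wordDeriv_cons, hder, h0]
      have : (fun p : Phase d => (((i : ℝ)⁻¹ ^ (n + 1) : ℝ) : ℂ) *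
          pdir 0 ψ ((i : ℝ)⁻¹ • p.2.2)) = 0 := by
        funext p
        simp [pdir]
      rw [this, wordDeriv_zero]
      simp
    rcases v with _ | ⟨_ | _, j⟩
    · exact hzero rfl
    · exact hzero rfl
    · have hψ' := hψ.pdir (dirVec (some (true, j) : Dir d)).2.2
      obtain ⟨C, hC⟩ := ih (n + 1) hψ' (hc.fderiv_apply ℝ _) fun R =>
        hψ'.comp (contDiff_snd.snd.const_smul _)
      refine ⟨C, fun i p => ?_⟩
      rw [wordDeriv_cons, hder, symbWeight_cons]
      convert hC i p using 3
      · simp [kOrd]; ring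
      · simp [tOrd]

/-- A smooth bump function on `ℝ^d`, equal to `1` on the unit ball. -/
def momentumBump (d : ℕ) : ContDiffBump (0 : EuclideanSpace ℝ (Fin d)) :=
  ⟨1, 2, one_pos, one_lt_two⟩

/-- The low-momentum cutoff at scale `R`. -/
def lowCut (d : ℕ) (R : ℝ) (p : Phase d) : ℂ := (momentumBump d (R⁻¹ • p.2.2) : ℝ)

lemma unifSymb_lowCut_pow (n : ℕ) :
    UnifSymb (-n : ℝ) 0 (fun (R : {R : ℝ // 1 ≤ R}) (p : Phase d) =>
      (((R : ℝ)⁻¹ ^ n : ℝ) : ℂ) * lowCut d R p) :=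
  unifSymb_scaled n (ψ := fun k => (momentumBump d k : ℂ))
    (Complex.ofRealCLM.contDiff.comp (momentumBump d).contDiff)
    ((momentumBump d).hasCompactSupport.comp_left (g := fun x : ℝ => (x : ℂ)) rfl)

lemma unifSymb_lowCut {R : ℝ} (hR : 1 ≤ R) (s : ℝ) :
    UnifSymb s 0 (fun _ : Unit => lowCut d R) := by
  obtain ⟨n, hn⟩ := exists_nat_ge (-s)
  have h := (((unifSymb_lowCut_pow (d := d) n).comp
    (fun _ : Unit => ⟨R, hR⟩)).const_mul ((R ^ n : ℝ) : ℂ)).mono (m' := s) (by linarith)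
  convert h using 3 with _ p
  have : (R : ℂ) ≠ 0 := by exact_mod_cast (by linarith : R ≠ 0)
  push_cast
  rw [inv_pow, mul_inv_cancel_left₀ (pow_ne_zero n this)]

lemma unifSymb_highCut :
    UnifSymb 0 0 (fun (R : {R : ℝ // 1 ≤ R}) => 1 - lowCut d R) := by
  have h := (unifSymb_const (ι := {R : ℝ // 1 ≤ R}) (d := d) 1).sub
    (by simpa using unifSymb_lowCut_pow (d := d) 0)
  exact h

lemma lowCut_eq_one {R : ℝ} (hR : 0 < R) {p : Phase d} (hp : ‖p.2.2‖ ≤ R) :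
    lowCut d R p = 1 := by
  unfold lowCut
  rw [(momentumBump d).one_of_mem_closedBall, Complex.ofReal_one]
  rw [mem_closedBall_zero_iff, norm_smul, norm_inv, Real.norm_of_nonneg hR.le,
    inv_mul_le_iff₀ hR]
  simpa [momentumBump] using hp

lemma wordDeriv_highCut_mul_eq_zero {R : ℝ} {a : Phase d → ℂ} (w : List (Dir d))
    {p : Phase d} (hp : ‖p.2.2‖ < R) : wordDeriv w ((1 - lowCut d R) * a) p = 0 := by
  have : (1 - lowCut d R) * a =ᶠ[𝓝 p] 0 := by
    have hc : Continuous fun q : Phase d => ‖q.2.2‖ := by fun_prop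
    filter_upwards [hc.continuousAt.eventually_lt_const hp] with q hq
    simp [lowCut_eq_one ((norm_nonneg _).trans_lt hq) hq.le]
  simpa [wordDeriv_zero] using (this.wordDeriv w).self_of_nhds

/-- Cutting off low momenta makes finitely many seminorms small in any larger order. -/
lemma exists_highCut_small {m m' δ ε R₀ : ℝ} {a : Phase d → ℂ}
    (ha : UnifSymb m δ (fun _ : Unit => a)) (hm : m < m') (hε : 0 < ε) (L : ℕ) :
    ∃ R : ℝ, 1 ≤ R ∧ R₀ ≤ R ∧ ∀ w : List (Dir d), w.length ≤ L → ∀ p,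
      ‖wordDeriv w ((1 - lowCut d R) * a) p‖ ≤ ε * symbWeight m' δ w p := by
  have hU := unifSymb_highCut.mul (ha.comp fun _ : {R : ℝ // 1 ≤ R} => ())
  rw [zero_add, zero_add] at hU
  choose C hC using hU.2
  have hlim : Filter.Tendsto (fun R : ℝ => R ^ (-(m' - m))) Filter.atTop (𝓝 0) :=
    tendsto_rpow_neg_atTop (by linarith)
  have hfin := List.finite_length_le (Dir d) L
  have hev : ∀ᶠ R : ℝ in Filter.atTop, ∀ w ∈ {w : List (Dir d) | w.length ≤ L},
      C w * R ^ (-(m' - m)) < ε := by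
    rw [Filter.eventually_all_finite hfin]
    intro w _
    have := hlim.const_mul (C w)
    rw [mul_zero] at this
    exact this.eventually_lt_const hε
  obtain ⟨R, hRw, hR1, hR0⟩ := (hev.and ((Filter.eventually_ge_atTop 1).and
    (Filter.eventually_ge_atTop R₀))).exists
  refine ⟨R, hR1, hR0, fun w hw p => ?_⟩
  rcases lt_or_ge ‖p.2.2‖ R with hp | hp
  · rw [wordDeriv_highCut_mul_eq_zero w hp, norm_zero]
    exact mul_nonneg hε.le (symbWeight_nonneg w p)
  have hR : 0 < R := by linarith
  have hC0 : 0 ≤ C w := by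
    have h1 := (norm_nonneg _).trans (hC w ⟨R, hR1⟩ p)
    have h2 : 0 < symbWeight m δ w p := by unfold symbWeight; positivity
    exact nonneg_of_mul_nonneg_left h1 h2
  have hgain : symbWeight m δ w p ≤ R ^ (-(m' - m)) * symbWeight m' δ w p := by
    have hb : 0 < 1 + ‖p.2.2‖ ^ 2 := by positivity
    have h1 : (1 + ‖p.2.2‖ ^ 2) ^ (-(m' - m) / 2) ≤ R ^ (-(m' - m)) := by
      calc (1 + ‖p.2.2‖ ^ 2) ^ (-(m' - m) / 2) ≤ (R ^ 2) ^ (-(m' - m) / 2) := by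
            apply Real.rpow_le_rpow_of_nonpos (by positivity)
            · nlinarith
            · linarith
        _ = R ^ (-(m' - m)) := by
            rw [← Real.rpow_natCast R 2, ← Real.rpow_mul hR.le]
            congr 1
            push_cast
            ring
    have h2 : symbWeight m δ w p =
        (1 + ‖p.2.2‖ ^ 2) ^ (-(m' - m) / 2) * symbWeight m' δ w p := by
      unfold symbWeight
      rw [mul_left_comm, ← Real.rpow_add hb]
      congr 2
      ring
    rw [h2]
    exact mul_le_mul_of_nonneg_right h1 (symbWeight_nonneg w p)
  calc _ ≤ C w * symbWeight m δ w p := hC w ⟨R, hR1⟩ p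
    _ ≤ C w * (R ^ (-(m' - m)) * symbWeight m' δ w p) := by gcongr
    _ = (C w * R ^ (-(m' - m))) * symbWeight m' δ w p := by ring
    _ ≤ ε * symbWeight m' δ w p :=
      mul_le_mul_of_nonneg_right (hRw w hw).le (symbWeight_nonneg w p)

end Cutoff

section Resummation

variable {d : ℕ}

/-- The locally finite sum of functions `f j` vanishing for `‖k‖ < j + 1`. -/
def momentumSum (f : ℕ → Phase d → ℂ) (p : Phase d) : ℂ :=
  ∑ j ∈ Finset.range (⌊‖p.2.2‖⌋₊ + 1), f j p

lemma momentumSum_eventuallyEq {f : ℕ → Phase d → ℂ}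
    (hf : ∀ (j : ℕ) p, ‖p.2.2‖ < (j : ℝ) + 1 → f j p = 0) {p : Phase d} {J : ℕ} (hp : ‖p.2.2‖ < J) :
    momentumSum f =ᶠ[𝓝 p] ∑ j ∈ Finset.range J, f j := by
  have hc : Continuous fun q : Phase d => ‖q.2.2‖ := by fun_prop
  filter_upwards [hc.continuousAt.eventually_lt_const hp] with q hq
  rw [momentumSum, Finset.sum_apply]
  refine Finset.sum_subset (fun j hj => ?_) fun j _ hj => hf j q ?_
  · have := (Nat.floor_lt (norm_nonneg _)).2 hq
    simp only [Finset.mem_range] at hj ⊢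
    omega
  · have h1 := Nat.lt_floor_add_one ‖q.2.2‖
    simp only [Finset.mem_range, not_lt] at hj
    have h2 : ((⌊‖q.2.2‖⌋₊ + 1 : ℕ) : ℝ) ≤ j := by exact_mod_cast hj
    push_cast at h2
    linarith

lemma contDiff_momentumSum {f : ℕ → Phase d → ℂ}
    (hf : ∀ (j : ℕ) p, ‖p.2.2‖ < (j : ℝ) + 1 → f j p = 0) (hs : ∀ j, ContDiff ℝ ∞ (f j)) :
    ContDiff ℝ ∞ (momentumSum f) := by
  rw [contDiff_iff_contDiffAt]
  intro p
  obtain ⟨J, hJ⟩ := exists_nat_gt ‖p.2.2‖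
  refine ContDiffAt.congr_of_eventuallyEq ?_ (momentumSum_eventuallyEq hf hJ)
  rw [show (∑ j ∈ Finset.range J, f j) = fun p => ∑ j ∈ Finset.range J, f j p by ext; simp]
  exact ContDiffAt.sum fun j _ => (hs j).contDiffAt

lemma norm_wordDeriv_momentumSum_sub_le {m : ℕ → ℝ} (hm : Antitone m) {δ : ℝ}
    {f : ℕ → Phase d → ℂ} (hf : ∀ (j : ℕ) p, ‖p.2.2‖ < (j : ℝ) + 1 → f j p = 0)
    (hs : ∀ j, ContDiff ℝ ∞ (f j))
    (hb : ∀ j, ∀ w : List (Dir d), w.length ≤ j + 1 → ∀ p,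
      ‖wordDeriv w (f (j + 1)) p‖ ≤ (1 / 2 : ℝ) ^ j * symbWeight (m j) δ w p)
    {M : ℕ} {w : List (Dir d)} (hw : w.length ≤ M + 1) (p : Phase d) :
    ‖wordDeriv w (momentumSum f - ∑ j ∈ Finset.range (M + 1), f j) p‖ ≤
      2 * symbWeight (m M) δ w p := by
  obtain ⟨J, hJ⟩ := exists_nat_gt ‖p.2.2‖
  have hJ' : ‖p.2.2‖ < ((M + 1 + J : ℕ) : ℝ) := by
    push_cast
    linarith [(Nat.cast_nonneg M : (0 : ℝ) ≤ M)]
  have heq : momentumSum f - ∑ j ∈ Finset.range (M + 1), f j =ᶠ[𝓝 p]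
      ∑ i ∈ Finset.range J, f (M + 1 + i) := by
    have h := (momentumSum_eventuallyEq hf hJ').sub
      (Filter.EventuallyEq.refl (𝓝 p) (∑ j ∈ Finset.range (M + 1), f j))
    rwa [Finset.sum_range_add _ (M + 1) J, add_sub_cancel_left] at h
  rw [(heq.wordDeriv w).self_of_nhds, wordDeriv_sum w _ fun i => hs _, Finset.sum_apply]
  calc ‖∑ i ∈ Finset.range J, wordDeriv w (f (M + 1 + i)) p‖
      ≤ ∑ i ∈ Finset.range J, (1 / 2 : ℝ) ^ i * symbWeight (m M) δ w p := by
        refine norm_sum_le_of_le _ fun i _ => ?_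
        rw [show M + 1 + i = M + i + 1 by ring]
        refine (hb (M + i) w (by omega) p).trans ?_
        refine mul_le_mul ?_ (symbWeight_mono (hm (by omega)) w p) (symbWeight_nonneg w p)
          (by positivity)
        exact pow_le_pow_of_le_one (by norm_num) (by norm_num) (by omega)
    _ = (∑ i ∈ Finset.range J, (1 / 2 : ℝ) ^ i) * symbWeight (m M) δ w p := by
        rw [Finset.sum_mul]
    _ ≤ 2 * symbWeight (m M) δ w p :=
        mul_le_mul_of_nonneg_right (sum_geometric_two_le J) (symbWeight_nonneg w p)

end Resummation

/-- (Resummation of symbols.) Let `δ ∈ ℝ` and let `(m_j)` be a strictly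
decreasing real sequence with `m_j → −∞`. Given `a_j ∈ S^{m_j,δ}_td`, there exists
`a ∈ S^{m_0,δ}_td` such that `a − Σ_{j=0}^{N} a_j ∈ S^{m_{N+1},δ}_td` for every `N`;
moreover `a` is unique modulo `⋂_m S^{m,δ}_td`. -/
theorem stmt14 (d : ℕ) (δ : ℝ) (m : ℕ → ℝ) (hm : StrictAnti m)
    (hmbot : Filter.Tendsto m Filter.atTop Filter.atBot)
    (a : ℕ → (ℝ × EuclideanSpace ℝ (Fin d) × EuclideanSpace ℝ (Fin d) → ℂ))
    (ha : ∀ j, SymbTD d (m j) δ (a j)) :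
    ∃ A : ℝ × EuclideanSpace ℝ (Fin d) × EuclideanSpace ℝ (Fin d) → ℂ,
      SymbTD d (m 0) δ A ∧
      (∀ N : ℕ, SymbTD d (m (N + 1)) δ (A - ∑ j ∈ Finset.range (N + 1), a j)) ∧
      (∀ A' : ℝ × EuclideanSpace ℝ (Fin d) × EuclideanSpace ℝ (Fin d) → ℂ,
        SymbTD d (m 0) δ A' →
        (∀ N : ℕ, SymbTD d (m (N + 1)) δ (A' - ∑ j ∈ Finset.range (N + 1), a j)) →
        ∀ m' : ℝ, SymbTD d m' δ (A - A')) := by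
  have ha' := fun j => symbTD_iff.1 (ha j)
  have hR : ∀ j : ℕ, ∃ R : ℝ, 1 ≤ R ∧ (j : ℝ) + 1 ≤ R ∧ ∀ i, j = i + 1 →
      ∀ w : List (Dir d), w.length ≤ j → ∀ p,
        ‖wordDeriv w ((1 - lowCut d R) * a j) p‖ ≤ (1 / 2 : ℝ) ^ i * symbWeight (m i) δ w p := by
    rintro (_ | i)
    · exact ⟨1, le_rfl, by simp, fun i hi => by omega⟩
    · obtain ⟨R, h1, h2, h3⟩ := exists_highCut_small (R₀ := ((i + 1 : ℕ) : ℝ) + 1)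
        (ha' (i + 1)) (hm (Nat.lt_succ_self i)) (by positivity : (0 : ℝ) < (1 / 2) ^ i) (i + 1)
      refine ⟨R, h1, h2, fun l hl => ?_⟩
      obtain rfl : i = l := by omega
      exact h3
  choose R hR1 hRj hRb using hR
  set f : ℕ → Phase d → ℂ := fun j => (1 - lowCut d (R j)) * a j with hf
  have hf0 : ∀ (j : ℕ) p, ‖p.2.2‖ < (j : ℝ) + 1 → f j p = 0 := fun j p hp =>
    wordDeriv_highCut_mul_eq_zero [] (hp.trans_le (hRj j))
  have hfU : ∀ j, UnifSymb (m j) δ (fun _ : Unit => f j) := fun j => by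
    simpa using (unifSymb_highCut.comp fun _ : Unit => ⟨R j, hR1 j⟩).mul (ha' j)
  have hfa : ∀ s j, UnifSymb s δ (fun _ : Unit => f j - a j) := fun s j => by
    convert ((unifSymb_lowCut (hR1 j) (s - m j)).mul (ha' j)).const_mul (-1) using 2
    · ring
    · ring
    · ext p
      simp [hf]
      ring
  have hfs : ∀ j, ContDiff ℝ ∞ (f j) := fun j => (hfU j).1 ()
  have hsm := contDiff_momentumSum hf0 hfs
  have hmain : ∀ N : ℕ, UnifSymb (m (N + 1)) δ
      (fun _ : Unit => momentumSum f - ∑ j ∈ Finset.range (N + 1), a j) := by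
    intro N
    have hlow : UnifSymb (m (N + 1)) δ
        (fun _ : Unit => ∑ j ∈ Finset.range (N + 1), (f j - a j)) :=
      UnifSymb.sum _ fun j _ => hfa _ j
    have hmid : ∀ L : ℕ, UnifSymb (m (N + 1)) δ
        (fun _ : Unit => ∑ i ∈ Finset.range (L + 1), f (N + 1 + i)) := fun L =>
      UnifSymb.sum _ fun i _ => (hfU _).mono (hm.antitone (by omega))
    have hsplit : ∀ L : ℕ, momentumSum f - ∑ j ∈ Finset.range (N + 1), a j =
        (momentumSum f - ∑ j ∈ Finset.range (N + 1 + L + 1), f j) +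
          (∑ i ∈ Finset.range (L + 1), f (N + 1 + i) +
            ∑ j ∈ Finset.range (N + 1), (f j - a j)) := fun L => by
      rw [add_assoc (N + 1), Finset.sum_range_add _ (N + 1) (L + 1), Finset.sum_sub_distrib]
      abel
    have hhigh : ∀ L : ℕ, ContDiff ℝ ∞
        (momentumSum f - ∑ j ∈ Finset.range (N + 1 + L + 1), f j) := fun L =>
      hsm.sub ((UnifSymb.sum _ fun j _ => (hfU j).mono (hm.antitone (Nat.zero_le j))).1 ())
    refine ⟨fun _ => ?_, fun w => ?_⟩
    · rw [hsplit 0]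
      exact (hhigh 0).add (((hmid 0).add hlow).1 ())
    · obtain ⟨C, hC⟩ := ((hmid w.length).add hlow).2 w
      refine ⟨2 + C, fun _ p => ?_⟩
      rw [hsplit w.length, wordDeriv_add w (hhigh _) (((hmid _).add hlow).1 ()), add_mul]
      refine (norm_add_le _ _).trans (add_le_add ?_ (hC () p))
      refine (norm_wordDeriv_momentumSum_sub_le hm.antitone hf0 hfs
        (fun j w hw => hRb (j + 1) j rfl w hw) (by omega) p).trans ?_
      exact mul_le_mul_of_nonneg_left (symbWeight_mono (hm.antitone (by omega)) w p) two_pos.le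
  refine ⟨momentumSum f, symbTD_iff.2 ?_, fun N => symbTD_iff.2 (hmain N), ?_⟩
  · convert ((hmain 0).mono (hm.antitone (Nat.zero_le 1))).add (ha' 0) using 2
    simp
  · intro A' _ hA' m'
    obtain ⟨N, hN⟩ := (hmbot.eventually (Filter.eventually_le_atBot m')).exists
    rw [symbTD_iff]
    convert ((hmain N).sub (symbTD_iff.1 (hA' N))).mono
      ((hm.antitone (Nat.le_succ N)).trans hN) using 2
    abel
end
end

section
/- Let μ > 1, C ≥ 0, and let b : ℝ × ℝ^d → ℝ^d be continuous, locally Lipschitz in its second variable, and satisfy |b(t,x)| ≤ C·⟨t⟩^{−μ} for all (t,x) ∈ ℝ × ℝ^d. Then for every s ∈ ℝ and x ∈ ℝ^d there is a unique global solution y : ℝ → ℝ^d of y'(t) = b(t, y(t)) with y(s) = x; moreover the limit y₊ := lim_{t→+∞} y(t) exists in ℝ^d and satisfies |y₊ − y(t)| ≤ C·∫_t^∞ ⟨σ⟩^{−μ} dσ for all t ∈ ℝ. -/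
open Set Filter Topology MeasureTheory
open scoped NNReal

section BoundedVectorField

variable {E : Type*} [NormedAddCommGroup E] {b : ℝ → E → E} {M : ℝ}

/-- A bounded vector field that is locally Lipschitz in the space variable is Lipschitz in the
space variable, uniformly in time, on every product of compact sets. -/
theorem exists_lipschitzOnWith_of_isCompact (hM : ∀ t x, ‖b t x‖ ≤ M)
    (hlip : ∀ p : ℝ × E, ∃ s ∈ 𝓝 p, ∃ K : ℝ, ∀ (t : ℝ) (x x' : E),
      (t, x) ∈ s → (t, x') ∈ s → ‖b t x - b t x'‖ ≤ K * ‖x - x'‖)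
    {I : Set ℝ} {B : Set E} (hI : IsCompact I) (hB : IsCompact B) :
    ∃ K : ℝ≥0, ∀ t ∈ I, LipschitzOnWith K (b t) B := by
  have hM0 : 0 ≤ M := (norm_nonneg _).trans (hM 0 0)
  have key : ∃ K : ℝ≥0, ∀ q ∈ I ×ˢ (B ×ˢ B),
      ‖b q.1 q.2.1 - b q.1 q.2.2‖ ≤ K * ‖q.2.1 - q.2.2‖ := by
    refine (hI.prod (hB.prod hB)).induction_on
      (p := fun S => ∃ K : ℝ≥0, ∀ q ∈ S, ‖b q.1 q.2.1 - b q.1 q.2.2‖ ≤ K * ‖q.2.1 - q.2.2‖)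
      ⟨0, by simp⟩ (fun S T hST ⟨K, hK⟩ => ⟨K, fun q hq => hK q (hST hq)⟩) ?_ ?_
    · rintro S T ⟨K, hK⟩ ⟨L, hL⟩
      refine ⟨max K L, ?_⟩
      rintro q (hq | hq)
      · exact (hK q hq).trans (by gcongr; exact le_max_left K L)
      · exact (hL q hq).trans (by gcongr; exact le_max_right K L)
    · rintro ⟨t, x, x'⟩ -
      by_cases hxx : x = x'
      · subst hxx
        obtain ⟨s, hs, K, hK⟩ := hlip (t, x)
        have h₁ : ∀ᶠ q : ℝ × E × E in 𝓝 (t, x, x), (q.1, q.2.1) ∈ s :=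
          (by fun_prop : Continuous fun q : ℝ × E × E => (q.1, q.2.1)).continuousAt hs
        have h₂ : ∀ᶠ q : ℝ × E × E in 𝓝 (t, x, x), (q.1, q.2.2) ∈ s :=
          (by fun_prop : Continuous fun q : ℝ × E × E => (q.1, q.2.2)).continuousAt hs
        refine ⟨_, mem_nhdsWithin_of_mem_nhds (h₁.and h₂), K.toNNReal, ?_⟩
        rintro q ⟨hq₁, hq₂⟩
        exact (hK _ _ _ hq₁ hq₂).trans (by gcongr; exact Real.le_coe_toNNReal K)
      · have hpos : 0 < ‖x - x'‖ := norm_pos_iff.2 (sub_ne_zero.2 hxx)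
        have h : ∀ᶠ q : ℝ × E × E in 𝓝 (t, x, x'), ‖x - x'‖ / 2 < ‖q.2.1 - q.2.2‖ :=
          (by fun_prop : Continuous fun q : ℝ × E × E => ‖q.2.1 - q.2.2‖).continuousAt.eventually
            (lt_mem_nhds (half_lt_self hpos))
        refine ⟨_, mem_nhdsWithin_of_mem_nhds h, (4 * M / ‖x - x'‖).toNNReal, fun q hq => ?_⟩
        rw [Real.coe_toNNReal _ (by positivity)]
        calc ‖b q.1 q.2.1 - b q.1 q.2.2‖ ≤ ‖b q.1 q.2.1‖ + ‖b q.1 q.2.2‖ := norm_sub_le _ _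
          _ ≤ M + M := add_le_add (hM _ _) (hM _ _)
          _ = 4 * M / ‖x - x'‖ * (‖x - x'‖ / 2) := by field_simp; ring
          _ ≤ 4 * M / ‖x - x'‖ * ‖q.2.1 - q.2.2‖ := by
            have : ‖x - x'‖ / 2 ≤ ‖q.2.1 - q.2.2‖ := le_of_lt hq
            gcongr
  obtain ⟨K, hK⟩ := key
  exact ⟨K, fun t ht => LipschitzOnWith.of_dist_le_mul fun x hx x' hx' => by
    simpa only [dist_eq_norm] using hK (t, x, x') ⟨ht, hx, hx'⟩⟩

variable [NormedSpace ℝ E] [ProperSpace E]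

/-- Two solutions of `y' = b t y` on an open interval, for a bounded vector field which is locally
Lipschitz in space, coincide as soon as they agree at the centre of the interval. -/
theorem eqOn_Ioo_of_hasDerivAt_of_bounded (hM : ∀ t x, ‖b t x‖ ≤ M)
    (hlip : ∀ p : ℝ × E, ∃ s ∈ 𝓝 p, ∃ K : ℝ, ∀ (t : ℝ) (x x' : E),
      (t, x) ∈ s → (t, x') ∈ s → ‖b t x - b t x'‖ ≤ K * ‖x - x'‖)
    {s r : ℝ} {y z : ℝ → E} (hr : 0 < r)
    (hy : ∀ t ∈ Ioo (s - r) (s + r), HasDerivAt y (b t (y t)) t)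
    (hz : ∀ t ∈ Ioo (s - r) (s + r), HasDerivAt z (b t (z t)) t) (hyz : y s = z s) :
    EqOn y z (Ioo (s - r) (s + r)) := by
  have hM0 : 0 ≤ M := (norm_nonneg _).trans (hM 0 0)
  obtain ⟨K, hK⟩ := exists_lipschitzOnWith_of_isCompact hM hlip
    (isCompact_Icc (a := s - r) (b := s + r)) (isCompact_closedBall (y s) (M * r))
  have hs : s ∈ Ioo (s - r) (s + r) := ⟨by linarith, by linarith⟩
  have mem_ball : ∀ w : ℝ → E, (∀ t ∈ Ioo (s - r) (s + r), HasDerivAt w (b t (w t)) t) →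
      ∀ t ∈ Ioo (s - r) (s + r), w t ∈ Metric.closedBall (w s) (M * r) := by
    intro w hw t ht
    have h := Convex.norm_image_sub_le_of_norm_hasDerivWithin_le
      (fun u hu => (hw u hu).hasDerivWithinAt) (fun u _ => hM u (w u)) (convex_Ioo _ _) hs ht
    have hts : ‖t - s‖ ≤ r := abs_le.2 ⟨by linarith [ht.1], by linarith [ht.2]⟩
    exact mem_closedBall_iff_norm.2 (h.trans (by gcongr))
  exact ODE_solution_unique_of_mem_Ioo (s := fun _ => Metric.closedBall (y s) (M * r))
    (fun t ht => hK t (Ioo_subset_Icc_self ht)) hs (fun t ht => ⟨hy t ht, mem_ball y hy t ht⟩)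
    (fun t ht => ⟨hz t ht, hyz ▸ mem_ball z hz t ht⟩) hyz

/-- For a bounded continuous vector field which is locally Lipschitz in space, the initial value
problem has a solution on each bounded open interval centred at the initial time. -/
theorem exists_forall_mem_Ioo_hasDerivAt_of_bounded
    (hcont : Continuous fun p : ℝ × E => b p.1 p.2) (hM : ∀ t x, ‖b t x‖ ≤ M)
    (hlip : ∀ p : ℝ × E, ∃ s ∈ 𝓝 p, ∃ K : ℝ, ∀ (t : ℝ) (x x' : E),
      (t, x) ∈ s → (t, x') ∈ s → ‖b t x - b t x'‖ ≤ K * ‖x - x'‖)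
    (s : ℝ) (x : E) {r : ℝ} (hr : 0 ≤ r) :
    ∃ y : ℝ → E, y s = x ∧ ∀ t ∈ Ioo (s - r) (s + r), HasDerivAt y (b t (y t)) t := by
  have hM0 : 0 ≤ M := (norm_nonneg _).trans (hM 0 0)
  obtain ⟨K, hK⟩ := exists_lipschitzOnWith_of_isCompact hM hlip
    (isCompact_Icc (a := s - r) (b := s + r)) (isCompact_closedBall x (M * r))
  have hs : s ∈ Icc (s - r) (s + r) := ⟨by linarith, by linarith⟩
  have hpl : IsPicardLindelof b (⟨s, hs⟩ : Icc (s - r) (s + r)) x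
      ⟨M * r, by positivity⟩ 0 ⟨M, hM0⟩ K :=
    { lipschitzOnWith := hK
      continuousOn := fun u _ =>
        (hcont.comp (by fun_prop : Continuous fun t : ℝ => (t, u))).continuousOn
      norm_le := fun t _ u _ => hM t u
      mul_max_le := (by simp : M * max (s + r - s) (s - (s - r)) ≤ M * r - 0) }
  obtain ⟨y, hys, hy⟩ := hpl.exists_eq_forall_mem_Icc_hasDerivWithinAt₀
  exact ⟨y, hys, fun t ht =>
    (hy t (Ioo_subset_Icc_self ht)).hasDerivAt (Icc_mem_nhds ht.1 ht.2)⟩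

/-- Global existence for a bounded continuous vector field which is locally Lipschitz in space. -/
theorem exists_forall_hasDerivAt_of_bounded
    (hcont : Continuous fun p : ℝ × E => b p.1 p.2) (hM : ∀ t x, ‖b t x‖ ≤ M)
    (hlip : ∀ p : ℝ × E, ∃ s ∈ 𝓝 p, ∃ K : ℝ, ∀ (t : ℝ) (x x' : E),
      (t, x) ∈ s → (t, x') ∈ s → ‖b t x - b t x'‖ ≤ K * ‖x - x'‖)
    (s : ℝ) (x : E) :
    ∃ y : ℝ → E, y s = x ∧ ∀ t, HasDerivAt y (b t (y t)) t := by
  choose! Y hYs hY using fun (r : ℝ) (hr : 0 ≤ r) =>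
    exists_forall_mem_Ioo_hasDerivAt_of_bounded hcont hM hlip s x hr
  have eq_of_mem : ∀ r t, |t - s| < r → Y (|t - s| + 1) t = Y r t := by
    intro r t ht
    set m := min (|t - s| + 1) r
    have h0 := abs_nonneg (t - s)
    have hm : |t - s| < m := lt_min (lt_add_one _) ht
    have hm₁ : m ≤ |t - s| + 1 := min_le_left _ _
    have hm₂ : m ≤ r := min_le_right _ _
    obtain ⟨h₁, h₂⟩ := abs_lt.1 hm
    exact eqOn_Ioo_of_hasDerivAt_of_bounded hM hlip (h0.trans_lt hm)
      (fun u hu => hY _ (by linarith) u ⟨by linarith [hu.1], by linarith [hu.2]⟩)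
      (fun u hu => hY _ (by linarith) u ⟨by linarith [hu.1], by linarith [hu.2]⟩)
      ((hYs _ (by linarith)).trans (hYs _ (by linarith)).symm)
      ⟨by linarith, by linarith⟩
  refine ⟨fun t => Y (|t - s| + 1) t, hYs _ (by positivity), fun t => ?_⟩
  have hev : (fun u => Y (|u - s| + 1) u) =ᶠ[𝓝 t] Y (|t - s| + 1) := by
    have : ∀ᶠ u in 𝓝 t, |u - s| < |t - s| + 1 :=
      (by fun_prop : Continuous fun u : ℝ => |u - s|).continuousAt.eventually
        (gt_mem_nhds (lt_add_one _))
    exact this.mono fun u hu => eq_of_mem _ _ hu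
  obtain ⟨h₁, h₂⟩ := abs_lt.1 (lt_add_one |t - s|)
  exact (hY _ (by positivity) t ⟨by linarith, by linarith⟩).congr_of_eventuallyEq hev

end BoundedVectorField

/-- A curve on `ℝ` whose velocity is dominated by an integrable function converges at `+∞`, at the
rate given by the tail of the integral. -/
theorem exists_tendsto_atTop_norm_sub_le_integral_Ioi {E : Type*} [NormedAddCommGroup E]
    [NormedSpace ℝ E] [CompleteSpace E] {y y' : ℝ → E} {g : ℝ → ℝ}
    (hy : ∀ t, HasDerivAt y (y' t) t) (hy' : AEStronglyMeasurable y')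
    (hg : Integrable g) (hle : ∀ t, ‖y' t‖ ≤ g t) :
    ∃ l : E, Tendsto y atTop (𝓝 l) ∧ ∀ t, ‖l - y t‖ ≤ ∫ σ in Ioi t, g σ := by
  have hint : Integrable y' := hg.mono' hy' (.of_forall hle)
  have hlim := tendsto_limUnder_of_hasDerivAt_of_integrableOn_Ioi (a := 0)
    (fun t _ => hy t) hint.integrableOn
  refine ⟨_, hlim, fun t => ?_⟩
  rw [← integral_Ioi_of_hasDerivAt_of_tendsto' (fun u _ => hy u) hint.integrableOn hlim]
  exact norm_integral_le_of_norm_le hg.integrableOn (.of_forall hle)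

/-- Let `μ > 1`, `C ≥ 0`, and let `b : ℝ × ℝ^d → ℝ^d` be continuous,
locally Lipschitz in its second variable, with `|b(t,x)| ≤ C·⟨t⟩^(−μ)`. Then for all
`s, x` there is a unique global solution `y` of `y' = b(t,y)`, `y(s) = x`; moreover
`y₊ := lim_{t→+∞} y(t)` exists and `|y₊ − y(t)| ≤ C·∫_t^∞ ⟨σ⟩^(−μ) dσ` for all `t`. -/
theorem stmt16 (d : ℕ) (μ C : ℝ) (hμ : 1 < μ) (hC : 0 ≤ C)
    (b : ℝ → EuclideanSpace ℝ (Fin d) → EuclideanSpace ℝ (Fin d))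
    (hcont : Continuous fun p : ℝ × EuclideanSpace ℝ (Fin d) => b p.1 p.2)
    (hlip : ∀ p : ℝ × EuclideanSpace ℝ (Fin d), ∃ s ∈ nhds p, ∃ K : ℝ,
      ∀ (t : ℝ) (x x' : EuclideanSpace ℝ (Fin d)), (t, x) ∈ s → (t, x') ∈ s →
        ‖b t x - b t x'‖ ≤ K * ‖x - x'‖)
    (hbound : ∀ (t : ℝ) (x : EuclideanSpace ℝ (Fin d)),
      ‖b t x‖ ≤ C * (1 + t ^ 2) ^ (-μ / 2 : ℝ)) :
    ∀ (s : ℝ) (x : EuclideanSpace ℝ (Fin d)),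
      ∃ y : ℝ → EuclideanSpace ℝ (Fin d),
        (y s = x ∧ ∀ t, HasDerivAt y (b t (y t)) t) ∧
        (∀ z : ℝ → EuclideanSpace ℝ (Fin d),
          (z s = x ∧ ∀ t, HasDerivAt z (b t (z t)) t) → z = y) ∧
        ∃ yp : EuclideanSpace ℝ (Fin d),
          Filter.Tendsto y Filter.atTop (nhds yp) ∧
          ∀ t : ℝ, ‖yp - y t‖ ≤ C * ∫ σ in Set.Ioi t, (1 + σ ^ 2) ^ (-μ / 2 : ℝ) := by
  intro s x
  have hM : ∀ t x, ‖b t x‖ ≤ C := fun t x => (hbound t x).trans <|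
    mul_le_of_le_one_right hC <|
      Real.rpow_le_one_of_one_le_of_nonpos (by nlinarith [sq_nonneg t]) (by linarith)
  obtain ⟨y, hys, hy⟩ := exists_forall_hasDerivAt_of_bounded hcont hM hlip s x
  have hyc : Continuous y := continuous_iff_continuousAt.2 fun t => (hy t).continuousAt
  have hint : Integrable fun σ : ℝ => (1 + σ ^ 2) ^ (-μ / 2 : ℝ) := by
    simpa using integrable_rpow_neg_one_add_norm_sq (E := ℝ) (μ := volume) (r := μ) (by simpa)
  obtain ⟨yp, hlim, hyp⟩ := exists_tendsto_atTop_norm_sub_le_integral_Ioi hy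
    (hcont.comp (continuous_id.prodMk hyc)).aestronglyMeasurable (hint.const_mul C)
    (fun t => hbound t (y t))
  refine ⟨y, ⟨hys, hy⟩, ?_, yp, hlim, fun t => (hyp t).trans_eq (integral_const_mul _ _)⟩
  rintro z ⟨hzs, hz⟩
  funext t
  obtain ⟨h₁, h₂⟩ := abs_lt.1 (lt_add_one |t - s|)
  exact eqOn_Ioo_of_hasDerivAt_of_bounded hM hlip (r := |t - s| + 1) (by positivity)
    (fun u _ => hz u) (fun u _ => hy u) (hzs.trans hys.symm) ⟨by linarith, by linarith⟩
end

section
/- Let μ > 1, C ≥ 0, and let b : ℝ × ℝ^d → ℝ^d be continuous with |b(t,x)| ≤ C·⟨t⟩^{−μ} and |b(t,x) − b(t,x')| ≤ C·⟨t⟩^{−μ}·|x − x'| for all t ∈ ℝ and x, x' ∈ ℝ^d. For s ∈ ℝ and x ∈ ℝ^d, let y(·, s, x) : ℝ → ℝ^d denote the unique global solution of ∂ₜy(t,s,x) = b(t, y(t,s,x)) with y(s,s,x) = x, and let y(+∞, s, x) := lim_{t→+∞} y(t,s,x) (which exists). Then there exists t₊ ∈ ℝ such that the map x ↦ y(+∞,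 t₊, x) is a bijection from ℝ^d onto ℝ^d, and in fact bi-Lipschitz: there is c' > 0 with c'·|x − x'| ≤ |y(+∞,t₊,x) − y(+∞,t₊,x')| ≤ (1/c')·|x − x'| for all x, x'. -/
/-- A map at Lipschitz distance `1 / 2` from the identity of a Banach space is surjective. -/
theorem surjective_of_norm_sub_sub_le_half {E : Type*} [NormedAddCommGroup E] [NormedSpace ℝ E]
    [CompleteSpace E] {f : E → E}
    (h : ∀ x x', ‖f x - f x' - (x - x')‖ ≤ 1 / 2 * ‖x - x'‖) : Function.Surjective f := by
  rcases subsingleton_or_nontrivial E with hE | hE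
  · exact fun z => ⟨z, Subsingleton.elim _ _⟩
  have hf : ApproximatesLinearOn f
      ((ContinuousLinearEquiv.refl ℝ E : E ≃L[ℝ] E) : E →L[ℝ] E) Set.univ (1 / 2) :=
    fun x _ x' _ => by simpa using h x x'
  refine hf.surjective (Or.inr ?_)
  have h1 : ‖(((ContinuousLinearEquiv.refl ℝ E).symm : E ≃L[ℝ] E) : E →L[ℝ] E)‖₊ = 1 :=
    NNReal.eq (ContinuousLinearMap.norm_id (𝕜 := ℝ) (E := E))
  rw [h1, inv_one]
  exact NNReal.half_lt_self one_ne_zero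

theorem one_add_sq_rpow_neg_half_le {μ t : ℝ} (hμ : 0 ≤ μ) (ht : 0 < t) :
    (1 + t ^ 2) ^ (-μ / 2 : ℝ) ≤ t ^ (-μ) := by
  calc (1 + t ^ 2) ^ (-μ / 2 : ℝ) ≤ (t ^ 2) ^ (-μ / 2 : ℝ) :=
        Real.rpow_le_rpow_of_nonpos (by positivity) (by linarith) (by linarith)
    _ = t ^ (-μ) := by
        rw [← Real.rpow_natCast, ← Real.rpow_mul ht.le]
        congr 1
        push_cast
        ring

/-- A solution of the differential inequality `‖u'‖ ≤ C t ^ (-μ) ‖u‖` stays close to its value at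
any sufficiently large initial time. -/
theorem norm_sub_initial_le_half {E : Type*} [NormedAddCommGroup E] [NormedSpace ℝ E]
    {μ C s : ℝ} (hμ : 1 < μ) (hC : 0 ≤ C) (hs : 0 < s)
    (hs' : 2 * (C + 1) / (μ - 1) * s ^ (-(μ - 1)) ≤ 1 / 2) {u u' : ℝ → E}
    (hu : ∀ t, HasDerivAt u (u' t) t) (hle : ∀ t, 0 < t → ‖u' t‖ ≤ C * t ^ (-μ) * ‖u t‖)
    (h0 : u s ≠ 0) {t : ℝ} (ht : s ≤ t) : ‖u t - u s‖ ≤ 1 / 2 * ‖u s‖ := by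
  set A := 2 * (C + 1) / (μ - 1) with hA
  have hμ' : 0 < μ - 1 := by linarith
  have hA0 : 0 ≤ A := by positivity
  have hn : 0 < ‖u s‖ := norm_pos_iff.mpr h0
  have hB : ∀ r ∈ Set.Icc s t, HasDerivAt (fun τ : ℝ => (1 / 2 - A * τ ^ (-(μ - 1))) * ‖u s‖)
      (2 * (C + 1) * r ^ (-μ) * ‖u s‖) r := by
    intro r hr
    have hr0 : 0 < r := hs.trans_le hr.1
    have h := (((Real.hasDerivAt_rpow_const (x := r) (p := -(μ - 1)) (Or.inl hr0.ne')).const_mul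
      A).const_sub (1 / 2)).mul_const ‖u s‖
    refine h.congr_deriv ?_
    rw [hA, show -(μ - 1) - 1 = -μ by ring]
    field_simp
  have key := image_norm_le_of_norm_deriv_right_lt_deriv_boundary'
    (f := fun τ => u τ - u s) (f' := u') (a := s) (b := t)
    (fun r _ => ((hu r).sub_const _).continuousAt.continuousWithinAt)
    (fun r _ => ((hu r).sub_const _).hasDerivWithinAt)
    (B := fun τ : ℝ => (1 / 2 - A * τ ^ (-(μ - 1))) * ‖u s‖)
    (B' := fun r => 2 * (C + 1) * r ^ (-μ) * ‖u s‖)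
    (by simpa using mul_nonneg (sub_nonneg.mpr hs') hn.le)
    (fun r hr => (hB r hr).continuousAt.continuousWithinAt)
    (fun r hr => (hB r (Set.Ico_subset_Icc_self hr)).hasDerivWithinAt)
    (by
      intro r hr heq
      have hr0 : 0 < r := hs.trans_le hr.1
      have hw : ‖u r - u s‖ ≤ 1 / 2 * ‖u s‖ := by
        rw [heq]
        gcongr
        linarith [mul_nonneg hA0 (Real.rpow_nonneg hr0.le (-(μ - 1)))]
      have hur : ‖u r‖ ≤ 2 * ‖u s‖ := by
        linarith [norm_sub_norm_le (u r) (u s)]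
      have hp : 0 < r ^ (-μ) := Real.rpow_pos_of_pos hr0 _
      calc ‖u' r‖ ≤ C * r ^ (-μ) * ‖u r‖ := hle r hr0
        _ ≤ C * r ^ (-μ) * (2 * ‖u s‖) := by gcongr
        _ < 2 * (C + 1) * r ^ (-μ) * ‖u s‖ := by linarith [mul_pos hp hn])
    (Set.right_mem_Icc.mpr ht)
  refine key.trans ?_
  gcongr
  linarith [mul_nonneg hA0 (Real.rpow_nonneg (hs.le.trans ht) (-(μ - 1)))]

/-- Let `μ > 1`, `C ≥ 0`, and let `b : ℝ × ℝ^d → ℝ^d` be continuous with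
`|b(t,x)| ≤ C·⟨t⟩^(−μ)` and `|b(t,x) − b(t,x')| ≤ C·⟨t⟩^(−μ)·|x − x'|`. Let `y(·,s,x)` be
the (unique) global solution of `∂ₜy = b(t,y)`, `y(s,s,x) = x`, and let
`y(+∞,s,x) = lim_{t→+∞} y(t,s,x)` (which exists). Then there is `t₊ ∈ ℝ` such that
`x ↦ y(+∞,t₊,x)` is a bijection of `ℝ^d`, and in fact bi-Lipschitz: there is `c' > 0` with
`c'·|x−x'| ≤ |y(+∞,t₊,x) − y(+∞,t₊,x')| ≤ (1/c')·|x−x'|` for all `x, x'`. -/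
theorem stmt17 (d : ℕ) (μ C : ℝ) (hμ : 1 < μ) (hC : 0 ≤ C)
    (b : ℝ → EuclideanSpace ℝ (Fin d) → EuclideanSpace ℝ (Fin d))
    (hcont : Continuous fun p : ℝ × EuclideanSpace ℝ (Fin d) => b p.1 p.2)
    (hbound : ∀ (t : ℝ) (x : EuclideanSpace ℝ (Fin d)),
      ‖b t x‖ ≤ C * (1 + t ^ 2) ^ (-μ / 2 : ℝ))
    (hlip : ∀ (t : ℝ) (x x' : EuclideanSpace ℝ (Fin d)),
      ‖b t x - b t x'‖ ≤ C * (1 + t ^ 2) ^ (-μ / 2 : ℝ) * ‖x - x'‖)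
    (y : ℝ → ℝ → EuclideanSpace ℝ (Fin d) → EuclideanSpace ℝ (Fin d))
    (hy0 : ∀ (s : ℝ) (x : EuclideanSpace ℝ (Fin d)), y s s x = x)
    (hyd : ∀ (s : ℝ) (x : EuclideanSpace ℝ (Fin d)) (t : ℝ),
      HasDerivAt (fun τ => y τ s x) (b t (y t s x)) t)
    (yinf : ℝ → EuclideanSpace ℝ (Fin d) → EuclideanSpace ℝ (Fin d))
    (hyinf : ∀ (s : ℝ) (x : EuclideanSpace ℝ (Fin d)),
      Filter.Tendsto (fun t => y t s x) Filter.atTop (nhds (yinf s x))) :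
    ∃ tp : ℝ, Function.Bijective (yinf tp) ∧
      ∃ c' : ℝ, 0 < c' ∧
        ∀ x x' : EuclideanSpace ℝ (Fin d),
          c' * ‖x - x'‖ ≤ ‖yinf tp x - yinf tp x'‖ ∧
          ‖yinf tp x - yinf tp x'‖ ≤ (1 / c') * ‖x - x'‖ := by
  obtain ⟨s, hs', hs⟩ : ∃ s : ℝ, 2 * (C + 1) / (μ - 1) * s ^ (-(μ - 1)) ≤ 1 / 2 ∧ 0 < s := by
    have h := (tendsto_rpow_neg_atTop (sub_pos.mpr hμ)).const_mul (2 * (C + 1) / (μ - 1))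
    rw [mul_zero] at h
    exact ((h.eventually_le_const one_half_pos).and (Filter.eventually_gt_atTop 0)).exists
  have key : ∀ x x', ‖yinf s x - yinf s x' - (x - x')‖ ≤ 1 / 2 * ‖x - x'‖ := by
    intro x x'
    rcases eq_or_ne x x' with rfl | hne
    · simp
    refine le_of_tendsto (((hyinf s x).sub (hyinf s x')).sub_const (x - x')).norm ?_
    filter_upwards [Filter.eventually_ge_atTop s] with t ht
    have h := norm_sub_initial_le_half hμ hC hs hs' (u := fun τ => y τ s x - y τ s x')
      (fun τ => (hyd s x τ).sub (hyd s x' τ))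
      (fun τ hτ => (hlip τ _ _).trans (by
        gcongr
        exact one_add_sq_rpow_neg_half_le (by linarith) hτ))
      (by simpa [hy0, sub_eq_zero] using hne) ht
    simpa only [hy0] using h
  have hlow : ∀ x x', 1 / 2 * ‖x - x'‖ ≤ ‖yinf s x - yinf s x'‖ := fun x x' => by
    have h := norm_sub_norm_le (x - x') (yinf s x - yinf s x')
    rw [norm_sub_rev (x - x')] at h
    linarith [key x x']
  refine ⟨s, ⟨fun x x' hxx => ?_, surjective_of_norm_sub_sub_le_half key⟩, 1 / 2, one_half_pos,
    fun x x' => ⟨hlow x x', ?_⟩⟩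
  · have h := hlow x x'
    rw [hxx, sub_self, norm_zero] at h
    exact sub_eq_zero.mp (norm_le_zero_iff.mp (by linarith))
  · have h := norm_sub_norm_le (yinf s x - yinf s x') (x - x')
    linarith [key x x', norm_nonneg (x - x')]
end
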